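/- For every d ≥ 1 and every invertible positive definite K ∈ ℝ^{d×d} there exist constants C₃, C₄ > 0 depending only on d and K such that the following holds: under Assumption (H), if E[‖A‖_HS^8] < ∞ then max{ d_TV(F,G), W_2(F,G) } ≤ C₃·‖E[A]−K‖_HS + C₄·E[‖A−K‖_HS^8]^{1/4}. -/

import Mathlib

open MeasureTheory ProbabilityTheory Matrix

noncomputable section

/-- Euclidean norm on `Fin d → ℝ`. -/
def euclNorm {d : ℕ} (x : Fin d → ℝ) : ℝ := Real.sqrt (∑ i, x i ^ 2)

/-- Hilbert–Schmidt norm of a matrix. -/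
def hsNorm {d : ℕ} (M : Matrix (Fin d) (Fin d) ℝ) : ℝ := Real.sqrt (∑ i, ∑ j, M i j ^ 2)

/-- Operator norm of a matrix (w.r.t. the Euclidean norm). -/
def opNorm {d : ℕ} (M : Matrix (Fin d) (Fin d) ℝ) : ℝ :=
  sSup {r : ℝ | ∃ x : Fin d → ℝ, euclNorm x = 1 ∧ r = euclNorm (M.mulVec x)}

/-- Smallest eigenvalue of a symmetric matrix (as the infimum of the Rayleigh quotient). -/
def lambdaMin {d : ℕ} (M : Matrix (Fin d) (Fin d) ℝ) : ℝ :=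
  sInf {r : ℝ | ∃ x : Fin d → ℝ, euclNorm x = 1 ∧ r = x ⬝ᵥ M.mulVec x}

/-- Density of the centered Gaussian law `N_d(0, M)` on `ℝ^d`. -/
def gaussDensity {d : ℕ} (M : Matrix (Fin d) (Fin d) ℝ) (x : Fin d → ℝ) : ℝ :=
  (Real.sqrt ((2 * Real.pi) ^ d * M.det))⁻¹ * Real.exp (-(1/2) * (x ⬝ᵥ M⁻¹.mulVec x))

/-- The centered Gaussian law `N_d(0, M)` on `ℝ^d` (for `M` positive definite). -/
def gaussLaw {d : ℕ} (M : Matrix (Fin d) (Fin d) ℝ) : Measure (Fin d → ℝ) :=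
  volume.withDensity fun x => ENNReal.ofReal (gaussDensity M x)

/-- Relative entropy (Kullback–Leibler divergence) of `μ` with respect to `ν`. -/
def relEnt {E : Type*} [MeasurableSpace E] (μ ν : Measure E) : ℝ :=
  ∫ x, Real.log ((μ.rnDeriv ν x).toReal) ∂μ

/-- `F` is a centered, integrable random vector which is conditionally Gaussian with respect to
the σ-field `𝓕`, with conditional covariance matrix `A`. -/
def CondGaussian {Ω : Type*} [MeasurableSpace Ω] (P : Measure Ω) {d : ℕ}
    (F : Ω → Fin d → ℝ) (𝓕 : MeasurableSpace Ω)
    (A : Ω → Matrix (Fin d) (Fin d) ℝ) : Prop :=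
  Integrable F P ∧ (∫ ω, F ω ∂P) = 0 ∧
  (∀ ω, (A ω).PosSemidef) ∧
  Measurable[𝓕] (fun ω i j => A ω i j) ∧
  ∀ y : Fin d → ℝ,
    P[(fun ω => Complex.exp (Complex.I * ((y ⬝ᵥ F ω : ℝ) : ℂ))) | 𝓕] =ᵐ[P]
      fun ω => ((Real.exp (-(1/2) * (y ⬝ᵥ (A ω).mulVec y)) : ℝ) : ℂ)

/-- The dimensional constant `2√6 + 3√2 + 2 + √d`. -/
def Cfac (d : ℕ) : ℝ := 2 * Real.sqrt 6 + 3 * Real.sqrt 2 + 2 + Real.sqrt d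

/-- `max{ |log(2^d det K/(2‖K‖_op + λ(K))^d)| , log(2^d det K/λ(K)^d) }`. -/
def maxLog {d : ℕ} (K : Matrix (Fin d) (Fin d) ℝ) : ℝ :=
  max |Real.log ((2 ^ d * K.det) / ((2 * opNorm K + lambdaMin K) ^ d))|
      (Real.log ((2 ^ d * K.det) / (lambdaMin K ^ d)))


/-- Total variation distance between two measures. -/
def dTV {E : Type*} [MeasurableSpace E] (μ ν : Measure E) : ℝ :=
  sSup {r : ℝ | ∃ B : Set E, MeasurableSet B ∧ r = |(μ B).toReal - (ν B).toReal|}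

/-- 2-Wasserstein distance between two measures on `ℝ^d` (with the Euclidean cost). -/
def W2 {d : ℕ} (μ ν : Measure (Fin d → ℝ)) : ℝ :=
  sInf {r : ℝ | ∃ π : Measure ((Fin d → ℝ) × (Fin d → ℝ)), IsProbabilityMeasure π ∧
    π.map Prod.fst = μ ∧ π.map Prod.snd = ν ∧
    r = Real.sqrt (∫ p, (∑ i, (p.1 i - p.2 i) ^ 2) ∂π)}

end

open MeasureTheory ProbabilityTheory Matrix
open scoped ENNReal NNReal

lemma pi_gauss_eq {d : ℕ} : (Measure.pi fun _ : Fin d => gaussianReal 0 1) =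
    (volume : Measure (Fin d → ℝ)).withDensity
      (fun x => ENNReal.ofReal (∏ i, gaussianPDFReal 0 1 (x i))) := by
  have hIntg : Integrable (fun x : Fin d → ℝ => ∏ i, gaussianPDFReal 0 1 (x i)) volume :=
    Integrable.fintype_prod (f := fun _ => gaussianPDFReal 0 1)
      (fun i => integrable_gaussianPDFReal 0 1)
  refine Measure.pi_eq fun s hs => ?_
  rw [withDensity_apply _ (MeasurableSet.univ_pi hs),
    ← ofReal_integral_eq_lintegral_ofReal hIntg.integrableOn
      (Filter.Eventually.of_forall fun x => Finset.prod_nonneg fun i _ => gaussianPDFReal_nonneg _ _ _),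
    volume_pi, Measure.restrict_pi_pi, integral_fintype_prod_eq_prod (fun i => gaussianPDFReal 0 1),
    ENNReal.ofReal_prod_of_nonneg]
  · refine Finset.prod_congr rfl fun i _ => ?_
    rw [gaussianReal_apply_eq_integral _ (by norm_num)]
  · intro i _
    exact integral_nonneg fun x => gaussianPDFReal_nonneg _ _ _

open scoped MatrixOrder Matrix.Norms.L2Operator in
lemma posDef_fact {d : ℕ} {M : Matrix (Fin d) (Fin d) ℝ} (hM : M.PosDef) :
    ∃ B : Matrix (Fin d) (Fin d) ℝ, B * Bᵀ = M ∧ B.det ≠ 0 := by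
  obtain ⟨B, hB⟩ := CStarAlgebra.nonneg_iff_eq_mul_star_self.mp (hM.posSemidef.nonneg)
  have hB' : B * Bᵀ = M := by rw [hB]; simp [Matrix.star_eq_conjTranspose]
  refine ⟨B, hB', fun h => ?_⟩
  have := hM.det_pos
  rw [← hB'] at this
  simp [h] at this

lemma gaussLaw_eq_map {d : ℕ} {M : Matrix (Fin d) (Fin d) ℝ} (hM : M.PosDef) :
    ∃ B : Matrix (Fin d) (Fin d) ℝ, B * Bᵀ = M ∧
      gaussLaw M = (Measure.pi fun _ : Fin d => gaussianReal 0 1).map (toLin' B) := by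
  obtain ⟨B, hB, hdet⟩ := posDef_fact hM
  refine ⟨B, hB, ?_⟩
  rw [pi_gauss_eq]
  have hBm : Measurable (toLin' B) := (toLin' B).continuous_of_finiteDimensional.measurable
  have hBi : Measurable (toLin' B⁻¹) := (toLin' B⁻¹).continuous_of_finiteDimensional.measurable
  have hu : IsUnit B.det := hdet.isUnit
  have hcomp : ∀ x, toLin' B⁻¹ (toLin' B x) = x := by
    intro x; simp [Matrix.mulVec_mulVec, Matrix.nonsing_inv_mul B hu]
  have hmeas : Measurable fun x : Fin d → ℝ => ENNReal.ofReal (∏ i, gaussianPDFReal 0 1 (x i)) := by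
    fun_prop
  have hMdet : M.det = B.det ^ 2 := by rw [← hB]; simp [sq]
  have key : ∀ x : Fin d → ℝ, gaussDensity M x =
      |(B.det)⁻¹| * ∏ i, gaussianPDFReal 0 1 (toLin' B⁻¹ x i) := by
    intro x
    unfold gaussDensity gaussianPDFReal
    have h1 : x ⬝ᵥ M⁻¹.mulVec x = ∑ i, (toLin' B⁻¹ x i) ^ 2 := by
      rw [← hB, Matrix.mul_inv_rev, ← Matrix.mulVec_mulVec, Matrix.dotProduct_mulVec,
        ← Matrix.transpose_nonsing_inv, Matrix.vecMul_transpose]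
      simp [dotProduct, sq]
    rw [h1, Finset.prod_mul_distrib, ← Real.exp_sum, hMdet, Real.sqrt_mul (by positivity),
      Real.sqrt_sq_eq_abs, Finset.prod_const, Finset.card_univ, Fintype.card_fin, mul_inv,
      abs_inv]
    have h2 : Real.sqrt ((2 * Real.pi) ^ d) = (Real.sqrt (2 * Real.pi)) ^ d := by
      rw [Real.sqrt_eq_iff_mul_self_eq (by positivity) (by positivity), ← mul_pow,
        Real.mul_self_sqrt (by positivity)]
    rw [h2, Finset.mul_sum]
    simp only [NNReal.coe_one, mul_one, sub_zero, inv_pow]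
    rw [mul_comm ((√(2 * Real.pi) ^ d)⁻¹), mul_assoc]
    congr 4
    ext i; ring
  ext s hs
  unfold gaussLaw
  rw [Measure.map_apply hBm hs, withDensity_apply _ (hBm hs), withDensity_apply _ hs]
  have e1 : ∀ x, ENNReal.ofReal (gaussDensity M x) = ENNReal.ofReal |(B.det)⁻¹| *
      ENNReal.ofReal (∏ i, gaussianPDFReal 0 1 (toLin' B⁻¹ x i)) := by
    intro x; rw [key x, ENNReal.ofReal_mul (abs_nonneg _)]
  simp_rw [e1]
  rw [lintegral_const_mul _ (by exact hmeas.comp hBi)]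
  have e2 := Real.map_matrix_volume_pi_eq_smul_volume_pi hdet
  have e3 : ∫⁻ x in s, ENNReal.ofReal (∏ i, gaussianPDFReal 0 1 (toLin' B⁻¹ x i))
      ∂(Measure.map (toLin' B) volume) = ENNReal.ofReal |(B.det)⁻¹| *
        ∫⁻ x in s, ENNReal.ofReal (∏ i, gaussianPDFReal 0 1 (toLin' B⁻¹ x i)) := by
    rw [e2, Measure.restrict_smul, lintegral_smul_measure, smul_eq_mul]
  rw [← e3, setLIntegral_map hs (by exact hmeas.comp hBi) hBm]
  simp_rw [hcomp]

lemma gaussLaw_charFunDual {d : ℕ} {M : Matrix (Fin d) (Fin d) ℝ} (hM : M.PosDef)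
    (L : StrongDual ℝ (Fin d → ℝ)) (y : Fin d → ℝ) (hy : ∀ x, L x = y ⬝ᵥ x) :
    charFunDual (gaussLaw M) L = ((Real.exp (-(1/2) * (y ⬝ᵥ M.mulVec y)) : ℝ) : ℂ) := by
  obtain ⟨B, hB, h⟩ := gaussLaw_eq_map hM
  rw [h]
  have : (toLin' B : (Fin d → ℝ) → (Fin d → ℝ)) = LinearMap.toContinuousLinearMap (toLin' B) := rfl
  rw [this, charFunDual_map, charFunDual_pi]
  have h1 : ∀ i, charFunDual (gaussianReal 0 1)
      (((L.comp (LinearMap.toContinuousLinearMap (toLin' B)))).comp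
        (ContinuousLinearMap.single ℝ (fun _ : Fin d => ℝ) i)) =
      Complex.exp (-((Bᵀ *ᵥ y) i : ℂ) ^ 2 / 2) := by
    intro i
    have h2 : charFunDual (gaussianReal 0 1)
      (((L.comp (LinearMap.toContinuousLinearMap (toLin' B)))).comp
        (ContinuousLinearMap.single ℝ (fun _ : Fin d => ℝ) i)) =
        charFun (gaussianReal 0 1) ((Bᵀ *ᵥ y) i) := by
      rw [charFunDual_apply, charFun_apply_real]
      congr 1
      ext v
      congr 2
      simp only [ContinuousLinearMap.comp_apply, hy, LinearMap.coe_toContinuousLinearMap',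
        toLin'_apply, dotProduct_mulVec, ← mulVec_transpose]
      have h4 : (ContinuousLinearMap.single ℝ (fun _ : Fin d => ℝ) i) v = Pi.single i v := rfl
      rw [h4, dotProduct_single]
      push_cast
      rfl
    rw [h2, charFun_gaussianReal]
    congr 1
    simp
    ring
  rw [Finset.prod_congr rfl (fun i _ => h1 i), ← Complex.exp_sum]
  rw [Complex.ofReal_exp]
  congr 1
  have h3 : y ⬝ᵥ M *ᵥ y = ∑ i, ((Bᵀ *ᵥ y) i) ^ 2 := by
    rw [← hB, ← mulVec_mulVec, dotProduct_mulVec, ← mulVec_transpose]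
    simp [dotProduct, sq]
  rw [h3]
  push_cast
  rw [Finset.mul_sum]
  refine Finset.sum_congr rfl fun i _ => ?_
  ring

instance {d : ℕ} : IsGaussian (Measure.pi fun _ : Fin d => gaussianReal 0 1) := by
  have h := map_pi_eq_stdGaussian (ι := Fin d)
  have h2 : (Measure.pi fun _ : Fin d => gaussianReal 0 1) =
      (stdGaussian (EuclideanSpace ℝ (Fin d))).map (EuclideanSpace.equiv (Fin d) ℝ) := by
    rw [← h, Measure.map_map (by fun_prop) (by fun_prop)]
    exact Measure.map_id.symm
  rw [h2]
  infer_instance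

lemma gaussLaw_isGaussian {d : ℕ} {M : Matrix (Fin d) (Fin d) ℝ} (hM : M.PosDef) :
    IsGaussian (gaussLaw M) := by
  obtain ⟨B, hB, h⟩ := gaussLaw_eq_map hM
  rw [h]
  exact isGaussian_map (LinearMap.toContinuousLinearMap (toLin' B))

lemma dual_dot {d : ℕ} (L : StrongDual ℝ (Fin d → ℝ)) (x : Fin d → ℝ) :
    L x = (fun i => L (Pi.single i 1)) ⬝ᵥ x := by
  conv_lhs => rw [← L.sum_comp_single]
  refine Finset.sum_congr rfl fun i _ => ?_
  have : (Pi.single i (x i) : Fin d → ℝ) = x i • Pi.single i (1:ℝ) := by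
    rw [← Pi.single_smul]; simp
  simp [this, mul_comm]

lemma gaussLaw_mean {d : ℕ} {M : Matrix (Fin d) (Fin d) ℝ} (hM : M.PosDef) :
    (gaussLaw M)[id] = 0 := by
  have := gaussLaw_isGaussian hM
  obtain ⟨B, hB, h⟩ := gaussLaw_eq_map hM
  -- the law is symmetric
  have hneg : (gaussLaw M).map (fun x => -x) = gaussLaw M := by
    have : IsFiniteMeasure ((gaussLaw M).map (fun x : Fin d → ℝ => -x)) := by
      exact Measure.isFiniteMeasure_map _ _
    refine Measure.ext_of_charFunDual (funext fun L => ?_)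
    have hy := dual_dot L
    have h1 := charFunDual_map (μ := gaussLaw M) (-ContinuousLinearMap.id ℝ (Fin d → ℝ)) L
    have h2 : (⇑(-ContinuousLinearMap.id ℝ (Fin d → ℝ))) = fun x => -x := rfl
    rw [h2] at h1
    rw [h1, gaussLaw_charFunDual hM _ _ hy, gaussLaw_charFunDual hM _
      (-(fun i => L (Pi.single i 1)))]
    · simp [mulVec_neg]
    · intro x
      simp [hy x]
  have h1 : ∫ x, x ∂(gaussLaw M) = - ∫ x, x ∂(gaussLaw M) := by
    conv_lhs => rw [← hneg]
    rw [integral_map (by fun_prop) (by fun_prop), integral_neg]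
  have : ∫ x, x ∂(gaussLaw M) = 0 := self_eq_neg.mp h1
  simpa using this

open MeasureTheory ProbabilityTheory Matrix
open scoped ENNReal NNReal

/-- Residual coupling: weighted total variation controls a coupling. -/
lemma residual_coupling {E : Type*} [NormedAddCommGroup E] [MeasurableSpace E] [BorelSpace E]
    [SecondCountableTopology E]
    (μ ν : Measure E) [IsProbabilityMeasure μ] [IsProbabilityMeasure ν]
    (hμ : Integrable (fun x => ‖x‖ ^ 2) μ) (hν : Integrable (fun x => ‖x‖ ^ 2) ν)
    (η : ℝ) (h : ∀ φ : E → ℝ, Measurable φ → (∀ x, |φ x| ≤ 1 + ‖x‖ ^ 2) →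
      |∫ x, φ x ∂μ - ∫ x, φ x ∂ν| ≤ η) :
    ∃ π : Measure (E × E), IsProbabilityMeasure π ∧ π.map Prod.fst = μ ∧ π.map Prod.snd = ν ∧
      ∫⁻ p, ENNReal.ofReal (‖p.1 - p.2‖ ^ 2) ∂π ≤ ENNReal.ofReal (2 * η) := by
  obtain ⟨s, hs, h1, h2⟩ := hahn_decomposition μ ν
  -- common part and excesses
  set α : Measure E := μ.restrict s - ν.restrict s with hα
  set β : Measure E := ν.restrict sᶜ - μ.restrict sᶜ with hβ
  have le1 : ν.restrict s ≤ μ.restrict s := by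
    refine Measure.le_iff.2 fun t ht => ?_
    rw [Measure.restrict_apply ht, Measure.restrict_apply ht]
    exact h1 _ (ht.inter hs) Set.inter_subset_right
  have le2 : μ.restrict sᶜ ≤ ν.restrict sᶜ := by
    refine Measure.le_iff.2 fun t ht => ?_
    rw [Measure.restrict_apply ht, Measure.restrict_apply ht]
    exact h2 _ (ht.inter hs.compl) Set.inter_subset_right
  have a1 : α + ν.restrict s = μ.restrict s := Measure.sub_add_cancel_of_le le1
  have b1 : β + μ.restrict sᶜ = ν.restrict sᶜ := Measure.sub_add_cancel_of_le le2
  set m : Measure E := ν.restrict s + μ.restrict sᶜ with hm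
  have hμm : μ = α + m := by
    rw [hm, ← add_assoc, a1, Measure.restrict_add_restrict_compl hs]
  have hνm : ν = β + m := by
    rw [hm, add_comm (ν.restrict s), ← add_assoc, b1, add_comm,
      Measure.restrict_add_restrict_compl hs]
  have fα : IsFiniteMeasure α := isFiniteMeasure_of_le (μ.restrict s) Measure.sub_le
  have fβ : IsFiniteMeasure β := isFiniteMeasure_of_le (ν.restrict sᶜ) Measure.sub_le
  have fm : IsFiniteMeasure m := by rw [hm]; infer_instance
  have hmass : α Set.univ = β Set.univ := by
    have e1 : α Set.univ + m Set.univ = 1 := by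
      rw [← Measure.add_apply, ← hμm]; exact measure_univ
    have e2 : β Set.univ + m Set.univ = 1 := by
      rw [← Measure.add_apply, ← hνm]; exact measure_univ
    exact (ENNReal.add_left_inj (measure_ne_top m _)).1 (e1.trans e2.symm)
  set t := α Set.univ with ht
  have httop : t ≠ ∞ := measure_ne_top α _
  have hdiag : Measurable fun x : E => (x, x) := by fun_prop
  -- cost of the excess
  have hcost : ∫⁻ x, ENNReal.ofReal (‖x‖ ^ 2) ∂α + ∫⁻ x, ENNReal.ofReal (‖x‖ ^ 2) ∂β
      ≤ ENNReal.ofReal η := by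
    have iα : Integrable (fun x : E => ‖x‖ ^ 2) α :=
      (hμ.mono_measure (by rw [hμm]; exact Measure.le_add_right le_rfl))
    have iβ : Integrable (fun x : E => ‖x‖ ^ 2) β :=
      (hν.mono_measure (by rw [hνm]; exact Measure.le_add_right le_rfl))
    rw [← ofReal_integral_eq_lintegral_ofReal iα (Filter.Eventually.of_forall fun x => by positivity),
      ← ofReal_integral_eq_lintegral_ofReal iβ (Filter.Eventually.of_forall fun x => by positivity),
      ← ENNReal.ofReal_add (by positivity) (by positivity)]
    apply ENNReal.ofReal_le_ofReal
    have hsc : Disjoint s sᶜ := disjoint_compl_right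
    have A1 : ∫ x in s, ‖x‖ ^ 2 ∂μ = ∫ x, ‖x‖ ^ 2 ∂α + ∫ x in s, ‖x‖ ^ 2 ∂ν := by
      conv_lhs => rw [← a1]
      exact integral_add_measure iα hν.integrableOn
    have B1 : ∫ x in sᶜ, ‖x‖ ^ 2 ∂ν = ∫ x, ‖x‖ ^ 2 ∂β + ∫ x in sᶜ, ‖x‖ ^ 2 ∂μ := by
      conv_lhs => rw [← b1]
      exact integral_add_measure iβ hμ.integrableOn
    classical
    have := h (fun x => s.indicator (fun x => ‖x‖ ^ 2) x - sᶜ.indicator (fun x => ‖x‖ ^ 2) x)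
      (by
        apply Measurable.sub
        · exact Measurable.indicator (by fun_prop) hs
        · exact Measurable.indicator (by fun_prop) hs.compl)
      (by
        intro x
        by_cases hx : x ∈ s <;> simp [hx])
    rw [integral_sub (hμ.indicator hs) (hμ.indicator hs.compl),
      integral_sub (hν.indicator hs) (hν.indicator hs.compl),
      integral_indicator hs, integral_indicator hs.compl,
      integral_indicator hs, integral_indicator hs.compl] at this
    have := (le_abs_self _).trans this
    linarith
  by_cases ht0 : t = 0
  · have hα0 : α = 0 := Measure.measure_univ_eq_zero.1 ht0
    have hβ0 : β = 0 := Measure.measure_univ_eq_zero.1 (hmass ▸ ht0)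
    have hμν : μ = ν := by rw [hμm, hνm, hα0, hβ0]
    refine ⟨μ.map fun x => (x, x), Measure.isProbabilityMeasure_map hdiag.aemeasurable, ?_, ?_, ?_⟩
    · rw [Measure.map_map measurable_fst hdiag]; exact Measure.map_id
    · rw [Measure.map_map measurable_snd hdiag, ← hμν]; exact Measure.map_id
    · rw [lintegral_map (by fun_prop) hdiag]; simp
  · refine ⟨m.map (fun x => (x, x)) + t⁻¹ • α.prod β, ?_, ?_, ?_, ?_⟩
    · constructor
      rw [Measure.add_apply, Measure.map_apply hdiag MeasurableSet.univ, Measure.smul_apply,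
        Measure.prod_apply MeasurableSet.univ]
      simp only [Set.preimage_univ, lintegral_const, smul_eq_mul, ← hmass, ← ht]
      rw [← mul_assoc, ENNReal.inv_mul_cancel ht0 httop, one_mul, add_comm, ht,
        ← Measure.add_apply, ← hμm]
      exact measure_univ
    · rw [Measure.map_add _ _ measurable_fst, Measure.map_map measurable_fst hdiag,
        Measure.map_smul, Measure.map_fst_prod, ← hmass, smul_smul,
        ENNReal.inv_mul_cancel ht0 httop, one_smul]
      conv_rhs => rw [hμm, add_comm]
      congr 1
      exact Measure.map_id
    · rw [Measure.map_add _ _ measurable_snd, Measure.map_map measurable_snd hdiag,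
        Measure.map_smul, Measure.map_snd_prod, smul_smul,
        ENNReal.inv_mul_cancel ht0 httop, one_smul]
      conv_rhs => rw [hνm, add_comm]
      congr 1
      exact Measure.map_id
    · rw [lintegral_add_measure, lintegral_map (by fun_prop) hdiag, lintegral_smul_measure]
      simp only [sub_self, norm_zero, ne_eq, OfNat.ofNat_ne_zero, not_false_eq_true, zero_pow,
        ENNReal.ofReal_zero, lintegral_zero, zero_add, smul_eq_mul]
      have hb : ∫⁻ p, ENNReal.ofReal (‖p.1 - p.2‖ ^ 2) ∂(α.prod β) ≤
          ∫⁻ p, (ENNReal.ofReal 2 * ENNReal.ofReal (‖p.1‖ ^ 2) +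
            ENNReal.ofReal 2 * ENNReal.ofReal (‖p.2‖ ^ 2)) ∂(α.prod β) := by
        refine lintegral_mono fun p => ?_
        rw [← ENNReal.ofReal_mul (by norm_num), ← ENNReal.ofReal_mul (by norm_num),
          ← ENNReal.ofReal_add (by positivity) (by positivity)]
        apply ENNReal.ofReal_le_ofReal
        have := norm_sub_le p.1 p.2
        nlinarith [norm_nonneg (p.1 - p.2), sq_nonneg (‖p.1‖ - ‖p.2‖), norm_nonneg p.1,
          norm_nonneg p.2]
      have hc : ∫⁻ p, (ENNReal.ofReal 2 * ENNReal.ofReal (‖p.1‖ ^ 2) +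
            ENNReal.ofReal 2 * ENNReal.ofReal (‖p.2‖ ^ 2)) ∂(α.prod β) =
          t * (ENNReal.ofReal 2 * (∫⁻ x, ENNReal.ofReal (‖x‖ ^ 2) ∂α +
            ∫⁻ x, ENNReal.ofReal (‖x‖ ^ 2) ∂β)) := by
        rw [lintegral_prod _ (by fun_prop)]
        simp only
        have : ∀ x : E, ∫⁻ y, (ENNReal.ofReal 2 * ENNReal.ofReal (‖x‖ ^ 2) +
            ENNReal.ofReal 2 * ENNReal.ofReal (‖y‖ ^ 2)) ∂β =
            ENNReal.ofReal 2 * ENNReal.ofReal (‖x‖ ^ 2) * t +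
            ENNReal.ofReal 2 * ∫⁻ y, ENNReal.ofReal (‖y‖ ^ 2) ∂β := by
          intro x
          rw [lintegral_add_left (by fun_prop), lintegral_const, ← hmass,
            lintegral_const_mul _ (by fun_prop)]
        simp_rw [this]
        rw [lintegral_add_right _ (by fun_prop), lintegral_const, ← ht,
          lintegral_mul_const _ (by fun_prop), lintegral_const_mul _ (by fun_prop)]
        ring
      refine (mul_le_mul_right (hb.trans hc.le) _).trans ?_
      rw [← mul_assoc, ENNReal.inv_mul_cancel ht0 httop, one_mul,
        ENNReal.ofReal_mul (by norm_num)]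
      gcongr

/-- Gluing a coupling with the residual coupling. -/
lemma glue_coupling {E : Type*} [NormedAddCommGroup E] [MeasurableSpace E] [BorelSpace E]
    [SecondCountableTopology E] [CompleteSpace E]
    (π₀ π₁ : Measure (E × E)) [IsProbabilityMeasure π₀] [IsProbabilityMeasure π₁]
    (hg : π₀.map Prod.snd = π₁.map Prod.fst) :
    ∃ π : Measure (E × E), IsProbabilityMeasure π ∧ π.map Prod.fst = π₀.map Prod.fst ∧
      π.map Prod.snd = π₁.map Prod.snd ∧
      ∫⁻ p, ENNReal.ofReal (‖p.1 - p.2‖ ^ 2) ∂π ≤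
        2 * ∫⁻ p, ENNReal.ofReal (‖p.1 - p.2‖ ^ 2) ∂π₀ +
        2 * ∫⁻ p, ENNReal.ofReal (‖p.1 - p.2‖ ^ 2) ∂π₁ := by
  set κ : Kernel (E × E) E := (π₁.condKernel).comap Prod.snd measurable_snd with hκ
  set ρ : Measure ((E × E) × E) := π₀ ⊗ₘ κ with hρ
  have hdis : π₁.fst ⊗ₘ π₁.condKernel = π₁ := π₁.disintegrate π₁.condKernel
  have hfst : ρ.map Prod.fst = π₀ := Measure.fst_compProd π₀ κ
  have h23 : ρ.map (fun q => (q.1.2, q.2)) = π₁ := by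
    conv_rhs => rw [← hdis]
    refine Measure.ext_of_lintegral _ fun f hf => ?_
    rw [lintegral_map hf (by fun_prop), hρ, Measure.lintegral_compProd (by fun_prop),
      Measure.lintegral_compProd hf]
    simp only [hκ, Kernel.comap_apply]
    have : π₁.fst = π₀.map Prod.snd := hg.symm
    rw [this, lintegral_map _ measurable_snd]
    exact Measurable.lintegral_kernel_prod_right' hf
  refine ⟨ρ.map (fun q => (q.1.1, q.2)), Measure.isProbabilityMeasure_map (by fun_prop), ?_, ?_, ?_⟩
  · rw [Measure.map_map measurable_fst (by fun_prop)]
    conv_rhs => rw [← hfst]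
    rw [Measure.map_map measurable_fst (by fun_prop)]
    rfl
  · rw [Measure.map_map measurable_snd (by fun_prop)]
    conv_rhs => rw [← h23]
    rw [Measure.map_map measurable_snd (by fun_prop)]
    rfl
  · rw [lintegral_map (by fun_prop) (by fun_prop)]
    conv_rhs => rw [← hfst, ← h23]
    rw [lintegral_map (by fun_prop) (by fun_prop), lintegral_map (by fun_prop) (by fun_prop),
      ← lintegral_const_mul _ (by fun_prop), ← lintegral_const_mul _ (by fun_prop),
      ← lintegral_add_left (by fun_prop)]
    refine lintegral_mono fun q => ?_
    have h2 : (2 : ℝ≥0∞) = ENNReal.ofReal 2 := by simp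
    simp only
    rw [h2, ← ENNReal.ofReal_mul (by norm_num), ← ENNReal.ofReal_mul (by norm_num),
          ← ENNReal.ofReal_add (by positivity) (by positivity)]
    apply ENNReal.ofReal_le_ofReal
    have : ‖q.1.1 - q.2‖ ≤ ‖q.1.1 - q.1.2‖ + ‖q.1.2 - q.2‖ := norm_sub_le_norm_sub_add_norm_sub _ _ _
    nlinarith [norm_nonneg (q.1.1 - q.2), sq_nonneg (‖q.1.1 - q.1.2‖ - ‖q.1.2 - q.2‖)]

lemma W2_le_of_coupling {d : ℕ} (μ ν : Measure (Fin d → ℝ)) (π : Measure ((Fin d → ℝ) × (Fin d → ℝ)))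
    [IsProbabilityMeasure π] (h1 : π.map Prod.fst = ν) (h2 : π.map Prod.snd = μ) (c : ℝ) (hc : 0 ≤ c)
    (h : ∫⁻ p, ENNReal.ofReal (‖p.1 - p.2‖ ^ 2) ∂π ≤ ENNReal.ofReal (c ^ 2)) :
    W2 μ ν ≤ Real.sqrt d * c := by
  unfold W2
  apply le_trans (b := Real.sqrt (∫ p, (∑ i, (p.1 i - p.2 i) ^ 2) ∂(π.map Prod.swap)))
  apply csInf_le
  refine ⟨0, ?_⟩
  rotate_left
  refine ⟨π.map Prod.swap, Measure.isProbabilityMeasure_map (by fun_prop), ?_, ?_, rfl⟩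
  rotate_left 2
  rotate_left
  · rintro r ⟨_, _, _, _, rfl⟩
    exact Real.sqrt_nonneg _
  · rw [Measure.map_map measurable_fst measurable_swap, ← h2]; rfl
  · rw [Measure.map_map measurable_snd measurable_swap, ← h1]; rfl
  · rw [integral_map (by fun_prop) (by fun_prop)]
    refine Real.sqrt_le_iff.2 ⟨by positivity, ?_⟩
    rw [integral_eq_lintegral_of_nonneg_ae (Filter.Eventually.of_forall fun p => by
      show 0 ≤ ∑ i, _
      positivity) (by fun_prop)]
    refine ENNReal.toReal_le_of_le_ofReal (by positivity) ?_
    rw [mul_pow, Real.sq_sqrt (by positivity), ENNReal.ofReal_mul (by positivity)]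
    refine le_trans ?_ (mul_le_mul_right h _)
    rw [← lintegral_const_mul _ (by fun_prop)]
    refine lintegral_mono fun p => ?_
    rw [← ENNReal.ofReal_mul (by positivity)]
    apply ENNReal.ofReal_le_ofReal
    calc ∑ i, (p.2 i - p.1 i) ^ 2 ≤ ∑ i : Fin d, ‖p.1 - p.2‖ ^ 2 := by
          refine Finset.sum_le_sum fun i _ => ?_
          have := norm_le_pi_norm (p.1 - p.2) i
          rw [Real.norm_eq_abs] at this
          rw [← sq_abs, abs_sub_comm]
          gcongr
          exact this
      _ = _ := by simp

open MeasureTheory ProbabilityTheory Matrix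
open scoped ENNReal NNReal

lemma abs_exp_sub_one_sub_le (a : ℝ) : |Real.exp a - 1 - a| ≤ a ^ 2 * Real.exp |a| := by
  have h0 : 0 ≤ Real.exp a - 1 - a := by linarith [Real.add_one_le_exp a]
  rw [abs_of_nonneg h0]
  have h1 : Real.exp a - 1 ≤ a * Real.exp a := by
    have h := Real.add_one_le_exp (-a)
    have h2 : Real.exp (-a) * Real.exp a = 1 := by rw [← Real.exp_add]; simp
    nlinarith [Real.exp_pos a]
  rcases le_total 0 a with ha | ha
  · rw [abs_of_nonneg ha]
    nlinarith [Real.exp_pos a]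
  · have h3 : 1 ≤ Real.exp |a| := Real.one_le_exp (abs_nonneg a)
    have h4 := Real.add_one_le_exp a
    have h5 : Real.exp a - 1 - a ≤ a ^ 2 := by nlinarith
    nlinarith [sq_nonneg a]

lemma poly_exp_bound (b c : ℝ) (_hb : 0 ≤ b) (hc : 0 < c) :
    ∃ C : ℝ, 0 < C ∧ ∀ t : ℝ, 0 ≤ t → (1 + t) ^ 4 * Real.exp (b * (1 + t)) ≤ C * Real.exp (c * t ^ 2) := by
  refine ⟨24 * Real.exp ((b + 1) ^ 2 / (4 * c) + (b + 1)), by positivity, fun t ht => ?_⟩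
  have h1 : (1 + t) ^ 4 ≤ 24 * Real.exp (1 + t) := by
    have := Real.pow_div_factorial_le_exp (1 + t) (by linarith) 4
    have h4 : ((Nat.factorial 4 : ℕ) : ℝ) = 24 := by norm_num [Nat.factorial]
    rw [h4, div_le_iff₀ (by norm_num)] at this
    linarith
  calc (1 + t) ^ 4 * Real.exp (b * (1 + t)) ≤ 24 * Real.exp (1 + t) * Real.exp (b * (1 + t)) := by
        gcongr
    _ = 24 * Real.exp ((b + 1) * (1 + t)) := by rw [mul_assoc, ← Real.exp_add]; ring_nf
    _ ≤ 24 * Real.exp ((b + 1) ^ 2 / (4 * c) + (b + 1) + c * t ^ 2) := by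
        gcongr
        have : 0 ≤ (2 * c * t - (b + 1)) ^ 2 / (4 * c) := by positivity
        have e : (2 * c * t - (b + 1)) ^ 2 / (4 * c) = c * t ^ 2 - (b + 1) * t + (b + 1) ^ 2 / (4 * c) := by
          field_simp; ring
        nlinarith
    _ = _ := by rw [Real.exp_add, mul_assoc]

noncomputable def matB {d : ℕ} (N : Matrix (Fin d) (Fin d) ℝ) : ℝ := ∑ i, ∑ j, |N i j|

lemma matB_nonneg {d : ℕ} (N : Matrix (Fin d) (Fin d) ℝ) : 0 ≤ matB N :=
  Finset.sum_nonneg fun _ _ => Finset.sum_nonneg fun _ _ => abs_nonneg _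

lemma bil_bound {d : ℕ} (N : Matrix (Fin d) (Fin d) ℝ) (x y : Fin d → ℝ) :
    |x ⬝ᵥ N *ᵥ y| ≤ matB N * ‖x‖ * ‖y‖ := by
  have : x ⬝ᵥ N *ᵥ y = ∑ i, ∑ j, x i * (N i j * y j) := by
    simp [dotProduct, mulVec, Finset.mul_sum]
  rw [this, matB, Finset.sum_mul, Finset.sum_mul]
  refine (Finset.abs_sum_le_sum_abs _ _).trans (Finset.sum_le_sum fun i _ => ?_)
  rw [Finset.sum_mul, Finset.sum_mul]
  refine (Finset.abs_sum_le_sum_abs _ _).trans (Finset.sum_le_sum fun j _ => ?_)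
  rw [abs_mul, abs_mul]
  have h1 := norm_le_pi_norm x i
  have h2 := norm_le_pi_norm y j
  rw [Real.norm_eq_abs] at h1 h2
  calc |x i| * (|N i j| * |y j|) = |N i j| * |x i| * |y j| := by ring
    _ ≤ |N i j| * ‖x‖ * ‖y‖ := by gcongr

lemma gaussDensity_meas {d : ℕ} (M : Matrix (Fin d) (Fin d) ℝ) : Measurable (gaussDensity M) := by
  unfold gaussDensity dotProduct mulVec dotProduct
  fun_prop

lemma gaussDensity_pos {d : ℕ} {M : Matrix (Fin d) (Fin d) ℝ} (hM : M.PosDef) (x : Fin d → ℝ) :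
    0 < gaussDensity M x := by
  unfold gaussDensity
  have := hM.det_pos
  positivity

lemma gaussLaw_integral {d : ℕ} {M : Matrix (Fin d) (Fin d) ℝ} (hM : M.PosDef) (f : (Fin d → ℝ) → ℝ) :
    ∫ x, f x ∂(gaussLaw M) = ∫ x, gaussDensity M x * f x := by
  unfold gaussLaw
  rw [integral_withDensity_eq_integral_toReal_smul]
  · congr 1; ext x
    rw [ENNReal.toReal_ofReal (gaussDensity_pos hM x).le, smul_eq_mul]
  · exact (gaussDensity_meas M).ennreal_ofReal
  · exact Filter.Eventually.of_forall fun x => ENNReal.ofReal_lt_top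

lemma gauss_shift {d : ℕ} {M : Matrix (Fin d) (Fin d) ℝ} (hM : M.PosDef) (f : (Fin d → ℝ) → ℝ)
    (v : Fin d → ℝ) :
    ∫ z, f (z + v) ∂(gaussLaw M) =
      ∫ z, f z * Real.exp (z ⬝ᵥ M⁻¹ *ᵥ v - (1/2) * (v ⬝ᵥ M⁻¹ *ᵥ v)) ∂(gaussLaw M) := by
  rw [gaussLaw_integral hM, gaussLaw_integral hM,
    ← integral_sub_right_eq_self (fun z => gaussDensity M z * f (z + v)) v]
  congr 1; ext z
  rw [sub_add_cancel, mul_comm (f z), ← mul_assoc]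
  congr 1
  unfold gaussDensity
  rw [mul_assoc, ← Real.exp_add]
  congr 2
  have hs : v ⬝ᵥ M⁻¹ *ᵥ z = z ⬝ᵥ M⁻¹ *ᵥ v := by
    have hsym : (M⁻¹)ᵀ = M⁻¹ := by
      rw [Matrix.transpose_nonsing_inv]
      congr 1
      simpa using hM.isHermitian.eq
    rw [dotProduct_mulVec, ← mulVec_transpose, hsym, dotProduct_comm]
  simp only [mulVec_sub, dotProduct_sub, sub_dotProduct, hs]
  ring

noncomputable def psiF {d : ℕ} (M : Matrix (Fin d) (Fin d) ℝ) (φ : (Fin d → ℝ) → ℝ)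
    (y : Fin d → ℝ) : ℝ := ∫ z, φ (y + z) ∂(gaussLaw M)

noncomputable def DF {d : ℕ} (M : Matrix (Fin d) (Fin d) ℝ) (φ : (Fin d → ℝ) → ℝ)
    (y u : Fin d → ℝ) : ℝ := ∫ z, φ (y + z) * (z ⬝ᵥ M⁻¹ *ᵥ u) ∂(gaussLaw M)

lemma DF_smul {d : ℕ} (M : Matrix (Fin d) (Fin d) ℝ) (φ : (Fin d → ℝ) → ℝ)
    (y u : Fin d → ℝ) (c : ℝ) : DF M φ y (c • u) = c * DF M φ y u := by
  unfold DF
  rw [← integral_const_mul]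
  congr 1; ext z
  simp [mulVec_smul]
  ring

lemma psiF_meas {d : ℕ} {M : Matrix (Fin d) (Fin d) ℝ} (hM : M.PosDef) {φ : (Fin d → ℝ) → ℝ}
    (hφ : Measurable φ) : Measurable (psiF M φ) := by
  have := gaussLaw_isGaussian hM
  unfold psiF
  refine StronglyMeasurable.measurable ?_
  exact StronglyMeasurable.integral_prod_right (f := fun y z => φ (y + z))
    (Measurable.stronglyMeasurable (by fun_prop))

lemma DF_meas {d : ℕ} {M : Matrix (Fin d) (Fin d) ℝ} (hM : M.PosDef) {φ : (Fin d → ℝ) → ℝ}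
    (hφ : Measurable φ) : Measurable (fun p : (Fin d → ℝ) × (Fin d → ℝ) => DF M φ p.1 p.2) := by
  have := gaussLaw_isGaussian hM
  unfold DF
  refine StronglyMeasurable.measurable ?_
  refine StronglyMeasurable.integral_prod_right
    (f := fun (p : (Fin d → ℝ) × (Fin d → ℝ)) z => φ (p.1 + z) * (z ⬝ᵥ M⁻¹ *ᵥ p.2))
    (Measurable.stronglyMeasurable ?_)
  unfold Function.uncurry dotProduct mulVec dotProduct
  fun_prop

lemma wt_add {E : Type*} [SeminormedAddCommGroup E] (y z : E) :
    1 + ‖y + z‖ ^ 2 ≤ 2 * (1 + ‖y‖ ^ 2) * (1 + ‖z‖) ^ 2 := by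
  have h := norm_add_le y z
  have hy := norm_nonneg y
  have hz := norm_nonneg z
  have : ‖y + z‖ ^ 2 ≤ (‖y‖ + ‖z‖) ^ 2 := by gcongr
  nlinarith [sq_nonneg (‖y‖ - ‖z‖), mul_nonneg (sq_nonneg ‖y‖) hz, mul_nonneg hy hz,
    mul_nonneg (sq_nonneg ‖y‖) (sq_nonneg ‖z‖)]

set_option maxHeartbeats 1000000 in
lemma smoothing {d : ℕ} {M : Matrix (Fin d) (Fin d) ℝ} (hM : M.PosDef) :
    ∃ C : ℝ, 0 < C ∧ ∀ φ : (Fin d → ℝ) → ℝ, Measurable φ → (∀ x, |φ x| ≤ 1 + ‖x‖ ^ 2) →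
      (∀ y, Integrable (fun z => φ (y + z)) (gaussLaw M)) ∧
      (∀ y u, Integrable (fun z => φ (y + z) * (z ⬝ᵥ M⁻¹ *ᵥ u)) (gaussLaw M)) ∧
      (∀ y, |psiF M φ y| ≤ C * (1 + ‖y‖ ^ 2)) ∧
      (∀ y u, |DF M φ y u| ≤ C * (1 + ‖y‖ ^ 2) * ‖u‖) ∧
      (∀ y u, |psiF M φ (y + u) - psiF M φ y - DF M φ y u| ≤ C * (1 + ‖y‖ ^ 2) * ‖u‖ ^ 2) := by
  have hG := gaussLaw_isGaussian hM
  obtain ⟨c, hc, hIntg⟩ := IsGaussian.exists_integrable_exp_sq (gaussLaw M)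
  set b := matB M⁻¹ with hb
  have hb0 : 0 ≤ b := matB_nonneg _
  obtain ⟨C₁, hC₁, hbd⟩ := poly_exp_bound b c hb0 hc
  set I := ∫ z, Real.exp (c * ‖z‖ ^ 2) ∂(gaussLaw M) with hI
  have hI0 : 0 ≤ I := integral_nonneg fun z => (Real.exp_pos _).le
  -- master weight
  set w : (Fin d → ℝ) → ℝ := fun z => (1 + ‖z‖) ^ 4 * Real.exp (b * (1 + ‖z‖)) with hw
  have hwm : Measurable w := by fun_prop
  have hwi : Integrable w (gaussLaw M) := by
    refine (hIntg.const_mul C₁).mono' hwm.aestronglyMeasurable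
      (Filter.Eventually.of_forall fun z => ?_)
    rw [Real.norm_eq_abs, abs_of_nonneg (by positivity)]
    exact hbd _ (norm_nonneg z)
  set J := ∫ z, w z ∂(gaussLaw M) with hJ
  have hJ0 : 0 ≤ J := integral_nonneg fun z => by positivity
  have hw2 : ∀ z, (1 + ‖z‖) ^ 4 ≤ w z := fun z => by
    have : 1 ≤ Real.exp (b * (1 + ‖z‖)) := Real.one_le_exp (by positivity)
    exact le_mul_of_one_le_right (by positivity) this
  have hw3 : ∀ z, (1 + ‖z‖) ^ 2 ≤ w z := fun z => by
    refine le_trans ?_ (hw2 z)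
    exact pow_le_pow_right₀ (by linarith [norm_nonneg z]) (by norm_num)
  -- general bound : integrals dominated by const * w
  have gen : ∀ (f : (Fin d → ℝ) → ℝ) (a : ℝ), Measurable f → (∀ z, |f z| ≤ a * w z) →
      Integrable f (gaussLaw M) ∧ |∫ z, f z ∂(gaussLaw M)| ≤ a * J := by
    intro f a hf h
    refine ⟨(hwi.const_mul a).mono' hf.aestronglyMeasurable (Filter.Eventually.of_forall h), ?_⟩
    rw [← Real.norm_eq_abs, hJ, ← integral_const_mul]
    exact norm_integral_le_of_norm_le (hwi.const_mul a) (Filter.Eventually.of_forall h)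
  set C := 2 * J * (b ^ 2 + b + 1) + 4 * J + 2 * J * (b + 1) + 2 * J + 1 with hC
  have hCge : ∀ q, q ≤ 2 * J * (b ^ 2 + b + 1) + 4 * J + 2 * J * (b + 1) + 2 * J → q ≤ C := fun q h => by
    rw [hC]; linarith
  have hbJ : 0 ≤ J * b := by positivity
  have hbJ2 : 0 ≤ J * b ^ 2 := by positivity
  refine ⟨C, by positivity, fun φ hφ hφb => ?_⟩
  have hφ2 : ∀ y z, |φ (y + z)| ≤ 2 * (1 + ‖y‖ ^ 2) * (1 + ‖z‖) ^ 2 := fun y z =>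
    (hφb _).trans (wt_add y z)
  have g1 : ∀ y, Integrable (fun z => φ (y + z)) (gaussLaw M) ∧
      |∫ z, φ (y + z) ∂(gaussLaw M)| ≤ 2 * (1 + ‖y‖ ^ 2) * J := fun y =>
    gen _ _ (by fun_prop) fun z => (hφ2 y z).trans (by gcongr; exact hw3 z)
  have g2 : ∀ y u, Integrable (fun z => φ (y + z) * (z ⬝ᵥ M⁻¹ *ᵥ u)) (gaussLaw M) ∧
      |∫ z, φ (y + z) * (z ⬝ᵥ M⁻¹ *ᵥ u) ∂(gaussLaw M)| ≤ 2 * (1 + ‖y‖ ^ 2) * b * ‖u‖ * J := fun y u => by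
    refine gen _ _ ?_ fun z => ?_
    · unfold dotProduct mulVec dotProduct
      fun_prop
    · rw [abs_mul]
      have hz := norm_nonneg z
      calc |φ (y + z)| * |z ⬝ᵥ M⁻¹ *ᵥ u| ≤
          (2 * (1 + ‖y‖ ^ 2) * (1 + ‖z‖) ^ 2) * (b * ‖z‖ * ‖u‖) := by
            gcongr
            · exact hφ2 y z
            · exact bil_bound _ _ _
        _ = 2 * (1 + ‖y‖ ^ 2) * b * ‖u‖ * ((1 + ‖z‖) ^ 2 * ‖z‖) := by ring
        _ ≤ 2 * (1 + ‖y‖ ^ 2) * b * ‖u‖ * w z := by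
            gcongr
            refine le_trans ?_ (hw2 z)
            have : ‖z‖ ≤ (1 + ‖z‖) ^ 2 := by nlinarith
            calc (1 + ‖z‖) ^ 2 * ‖z‖ ≤ (1 + ‖z‖) ^ 2 * (1 + ‖z‖) ^ 2 := by gcongr
              _ = _ := by ring
  have hψ : ∀ y, |psiF M φ y| ≤ 2 * (1 + ‖y‖ ^ 2) * J := fun y => (g1 y).2
  have hD : ∀ y u, |DF M φ y u| ≤ 2 * (1 + ‖y‖ ^ 2) * b * ‖u‖ * J := fun y u => (g2 y u).2
  refine ⟨fun y => (g1 y).1, fun y u => (g2 y u).1, fun y => ?_, fun y u => ?_, fun y u => ?_⟩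
  · refine (hψ y).trans ?_
    calc 2 * (1 + ‖y‖ ^ 2) * J = (2 * J) * (1 + ‖y‖ ^ 2) := by ring
      _ ≤ _ := by gcongr; apply hCge; nlinarith
  · refine (hD y u).trans ?_
    calc 2 * (1 + ‖y‖ ^ 2) * b * ‖u‖ * J = (2 * J * b) * (1 + ‖y‖ ^ 2) * ‖u‖ := by ring
      _ ≤ _ := by gcongr; apply hCge; nlinarith
  · rcases le_total ‖u‖ 1 with hu | hu
    · -- small displacement
      have e1 : psiF M φ (y + u) = ∫ z, φ (y + z) *
          Real.exp (z ⬝ᵥ M⁻¹ *ᵥ u - (1/2) * (u ⬝ᵥ M⁻¹ *ᵥ u)) ∂(gaussLaw M) := by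
        unfold psiF
        rw [← gauss_shift hM (fun z => φ (y + z)) u]
        congr 1; ext z; congr 1; abel
      set a : (Fin d → ℝ) → ℝ := fun z => z ⬝ᵥ M⁻¹ *ᵥ u - (1/2) * (u ⬝ᵥ M⁻¹ *ᵥ u) with ha
      have ham : Measurable a := by
        simp only [ha]
        unfold dotProduct mulVec dotProduct
        fun_prop
      have hal : ∀ z, |a z| ≤ b * ‖u‖ * (1 + ‖z‖) := fun z => by
        have h1 := bil_bound M⁻¹ z u
        have h2 := bil_bound M⁻¹ u u
        have hz := norm_nonneg z
        have hu0 := norm_nonneg u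
        have h3 : |a z| ≤ |z ⬝ᵥ M⁻¹ *ᵥ u| + (1/2) * |u ⬝ᵥ M⁻¹ *ᵥ u| := by
          simp only [ha]
          refine (abs_sub _ _).trans ?_
          rw [abs_mul]; norm_num
        have h4 : b * ‖u‖ * ‖u‖ ≤ b * ‖u‖ * 1 := by gcongr
        have h5 : 0 ≤ b * ‖u‖ := by positivity
        rw [← hb] at h1 h2
        nlinarith
      have hrem : ∀ z, |Real.exp (a z) - 1 - z ⬝ᵥ M⁻¹ *ᵥ u| ≤
          (b ^ 2 + b) * ‖u‖ ^ 2 * ((1 + ‖z‖) ^ 2 * Real.exp (b * (1 + ‖z‖))) := fun z => by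
        have h1 := abs_exp_sub_one_sub_le (a z)
        have h2 := bil_bound M⁻¹ u u
        rw [← hb] at h2
        have hz := norm_nonneg z
        have hu0 := norm_nonneg u
        have e : Real.exp (a z) - 1 - z ⬝ᵥ M⁻¹ *ᵥ u = (Real.exp (a z) - 1 - a z) -
          (1/2) * (u ⬝ᵥ M⁻¹ *ᵥ u) := by simp only [ha]; ring
        have h3 : a z ^ 2 * Real.exp |a z| ≤ (b * ‖u‖ * (1 + ‖z‖)) ^ 2 * Real.exp (b * (1 + ‖z‖)) := by
          rw [← sq_abs]
          gcongr
          · exact hal z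
          · refine (hal z).trans ?_
            gcongr
            nlinarith
        have h4 : b * ‖u‖ * ‖u‖ ≤ b * ‖u‖ ^ 2 * ((1 + ‖z‖) ^ 2 * Real.exp (b * (1 + ‖z‖))) := by
          have : 1 ≤ (1 + ‖z‖) ^ 2 * Real.exp (b * (1 + ‖z‖)) :=
            one_le_mul_of_one_le_of_one_le (one_le_pow₀ (by linarith)) (Real.one_le_exp (by positivity))
          calc b * ‖u‖ * ‖u‖ = b * ‖u‖ ^ 2 * 1 := by ring
            _ ≤ _ := by gcongr
        rw [e]
        refine (abs_sub _ _).trans ?_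
        rw [abs_mul, abs_of_nonneg (by norm_num : (0:ℝ) ≤ 1/2)]
        nlinarith [abs_nonneg (u ⬝ᵥ M⁻¹ *ᵥ u)]
      have hlin : Measurable fun z : Fin d → ℝ => z ⬝ᵥ M⁻¹ *ᵥ u := by
        unfold dotProduct mulVec dotProduct
        fun_prop
      have g3 := gen (fun z => φ (y + z) * (Real.exp (a z) - 1 - z ⬝ᵥ M⁻¹ *ᵥ u))
        (2 * (1 + ‖y‖ ^ 2) * ((b ^ 2 + b) * ‖u‖ ^ 2)) (by fun_prop) (fun z => by
          rw [abs_mul]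
          calc _ ≤ (2 * (1 + ‖y‖ ^ 2) * (1 + ‖z‖) ^ 2) *
              ((b ^ 2 + b) * ‖u‖ ^ 2 * ((1 + ‖z‖) ^ 2 * Real.exp (b * (1 + ‖z‖)))) := by
                gcongr
                · exact hφ2 y z
                · exact hrem z
            _ = _ := by simp only [hw]; ring)
      have e2 : psiF M φ (y + u) - psiF M φ y - DF M φ y u =
          ∫ z, φ (y + z) * (Real.exp (a z) - 1 - z ⬝ᵥ M⁻¹ *ᵥ u) ∂(gaussLaw M) := by
        rw [e1]
        unfold psiF DF
        have i1 : Integrable (fun z => φ (y + z) * Real.exp (a z)) (gaussLaw M) := by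
          have := (g3.1.add (g1 y).1).add (g2 y u).1
          refine this.congr (Filter.Eventually.of_forall fun z => ?_)
          simp only [Pi.add_apply]
          ring
        rw [← integral_sub i1 (g1 y).1, ← integral_sub (by exact i1.sub (g1 y).1) (g2 y u).1]
        congr 1; ext z
        ring
      rw [e2]
      refine g3.2.trans ?_
      calc 2 * (1 + ‖y‖ ^ 2) * ((b ^ 2 + b) * ‖u‖ ^ 2) * J
          = (2 * J * (b ^ 2 + b)) * (1 + ‖y‖ ^ 2) * ‖u‖ ^ 2 := by ring
        _ ≤ _ := by gcongr; apply hCge; nlinarith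
    · -- large displacement
      have h1 := hψ (y + u)
      have h2 := hψ y
      have h3 := hD y u
      have hu2 : 1 ≤ ‖u‖ ^ 2 := one_le_pow₀ hu
      have hu3 : ‖u‖ ≤ ‖u‖ ^ 2 := by nlinarith
      have h4 : 1 + ‖y + u‖ ^ 2 ≤ 4 * (1 + ‖y‖ ^ 2) * ‖u‖ ^ 2 := by
        have h := norm_add_le y u
        have hy := norm_nonneg y
        have : ‖y + u‖ ^ 2 ≤ (‖y‖ + ‖u‖) ^ 2 := by gcongr
        nlinarith [sq_nonneg (‖y‖ - ‖u‖), mul_le_mul_of_nonneg_left hu2 (sq_nonneg ‖y‖)]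
      have t := abs_sub (psiF M φ (y + u) - psiF M φ y) (DF M φ y u)
      have t2 := abs_sub (psiF M φ (y + u)) (psiF M φ y)
      have h5 : 2 * (1 + ‖y + u‖ ^ 2) * J ≤ 2 * (4 * (1 + ‖y‖ ^ 2) * ‖u‖ ^ 2) * J := by gcongr
      have h6 : 2 * (1 + ‖y‖ ^ 2) * J ≤ 2 * ((1 + ‖y‖ ^ 2) * ‖u‖ ^ 2) * J := by
        gcongr; nlinarith [sq_nonneg ‖y‖]
      have h7 : 2 * (1 + ‖y‖ ^ 2) * b * ‖u‖ * J ≤ 2 * (1 + ‖y‖ ^ 2) * b * ‖u‖ ^ 2 * J := by gcongr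
      calc _ ≤ 2 * (4 * (1 + ‖y‖ ^ 2) * ‖u‖ ^ 2) * J + 2 * ((1 + ‖y‖ ^ 2) * ‖u‖ ^ 2) * J +
            2 * (1 + ‖y‖ ^ 2) * b * ‖u‖ ^ 2 * J :=
          t.trans (add_le_add (t2.trans (add_le_add (h1.trans h5) (h2.trans h6))) (h3.trans h7))
        _ = (2 * J * (b + 1) + 8 * J) * (1 + ‖y‖ ^ 2) * ‖u‖ ^ 2 := by ring
        _ ≤ C * (1 + ‖y‖ ^ 2) * ‖u‖ ^ 2 := by
          gcongr
          rw [hC]; nlinarith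

open MeasureTheory ProbabilityTheory Matrix
open scoped ENNReal NNReal

lemma quad_rem {V : Type*} [NormedAddCommGroup V] [NormedSpace ℝ V] {f : V → ℝ}
    (hf : ContDiffAt ℝ 2 f 0) :
    ∃ (ε C : ℝ) (ℓ : V →L[ℝ] ℝ), 0 < ε ∧ 0 < C ∧ ∀ v, ‖v‖ ≤ ε → |f v - f 0 - ℓ v| ≤ C * ‖v‖ ^ 2 := by
  have h1 : ContDiffAt ℝ 1 (fderiv ℝ f) 0 := hf.fderiv_right (by norm_num)
  obtain ⟨L, t, ht, hL⟩ := h1.exists_lipschitzOnWith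
  have h2 : ∀ᶠ v in nhds (0 : V), DifferentiableAt ℝ f v := by
    have := hf.eventually (by simp)
    filter_upwards [this] with v hv
    exact hv.differentiableAt (by norm_num)
  obtain ⟨ε, hε, hs⟩ := Metric.mem_nhds_iff.1 (Filter.inter_mem ht h2)
  refine ⟨ε / 2, L + 1, fderiv ℝ f 0, by positivity, by positivity, fun v hv => ?_⟩
  have hsub : ∀ w ∈ Metric.closedBall (0 : V) ‖v‖, w ∈ t ∧ DifferentiableAt ℝ f w := fun w hw => by
    have : w ∈ Metric.ball (0 : V) ε := by
      rw [mem_closedBall_zero_iff] at hw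
      rw [mem_ball_zero_iff]; linarith
    exact hs this
  have h0 : (0 : V) ∈ Metric.closedBall (0 : V) ‖v‖ := by simp
  have hv' : v ∈ Metric.closedBall (0 : V) ‖v‖ := by simp
  have := Convex.norm_image_sub_le_of_norm_hasFDerivWithin_le' (𝕜 := ℝ) (f := f)
    (f' := fderiv ℝ f) (φ := fderiv ℝ f 0) (C := L * ‖v‖) (s := Metric.closedBall (0 : V) ‖v‖)
    (fun w hw => (hsub w hw).2.hasFDerivAt.hasFDerivWithinAt)
    (fun w hw => by
      have h3 := hL.dist_le_mul w (hsub w hw).1 0 (hsub 0 h0).1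
      rw [dist_eq_norm, dist_zero_right] at h3
      refine h3.trans ?_
      rw [mem_closedBall_zero_iff] at hw
      gcongr)
    (convex_closedBall _ _) h0 hv'
  rw [sub_zero, Real.norm_eq_abs] at this
  refine this.trans ?_
  nlinarith [sq_nonneg ‖v‖]

lemma contDiff_det {d : ℕ} {V : Type*} [NormedAddCommGroup V] [NormedSpace ℝ V]
    (N : V → Matrix (Fin d) (Fin d) ℝ) (h : ∀ i j, ContDiff ℝ 2 fun v => N v i j) :
    ContDiff ℝ 2 fun v => (N v).det := by
  simp only [Matrix.det_apply]
  refine ContDiff.sum fun σ _ => ?_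
  refine ContDiff.const_smul _ ?_
  exact contDiff_prod fun i _ => h _ _

lemma contDiffAt_inv_entry {d : ℕ} {V : Type*} [NormedAddCommGroup V] [NormedSpace ℝ V]
    (N : V → Matrix (Fin d) (Fin d) ℝ) (h : ∀ i j, ContDiff ℝ 2 fun v => N v i j)
    (h0 : (N 0).det ≠ 0) (i j : Fin d) :
    ContDiffAt ℝ 2 (fun v => (N v)⁻¹ i j) 0 := by
  have e : (fun v => (N v)⁻¹ i j) = fun v => (N v).det⁻¹ * (N v).adjugate i j := by
    ext v
    rw [Matrix.inv_def, Ring.inverse_eq_inv', Matrix.smul_apply, smul_eq_mul]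
  rw [e]
  refine ContDiffAt.mul ?_ ?_
  · exact (contDiff_det N h).contDiffAt.inv h0
  · simp only [Matrix.adjugate_apply]
    refine (contDiff_det _ fun k l => ?_).contDiffAt
    simp only [Matrix.updateRow_apply]
    split_ifs
    · exact contDiff_const
    · exact h _ _

lemma mulVec_norm_le {d : ℕ} (N : Matrix (Fin d) (Fin d) ℝ) (y : Fin d → ℝ) :
    ‖N *ᵥ y‖ ≤ matB N * ‖y‖ := by
  rw [pi_norm_le_iff_of_nonneg (mul_nonneg (matB_nonneg N) (norm_nonneg y))]
  intro i
  have := bil_bound N (Pi.single i 1) y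
  rw [single_one_dotProduct, Pi.norm_single, norm_one, mul_one] at this
  exact this

lemma posDef_lower {d : ℕ} {M : Matrix (Fin d) (Fin d) ℝ} (hM : M.PosDef) :
    ∃ c : ℝ, 0 < c ∧ ∀ x : Fin d → ℝ, c * ‖x‖ ^ 2 ≤ x ⬝ᵥ M *ᵥ x := by
  obtain ⟨B, hB, hdet⟩ := posDef_fact hM
  set b := matB (Bᵀ)⁻¹ + 1 with hb
  have hb1 : 0 < b := by have := matB_nonneg (Bᵀ)⁻¹; linarith
  refine ⟨(b ^ 2)⁻¹, by positivity, fun x => ?_⟩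
  have h1 : x = (Bᵀ)⁻¹ *ᵥ (Bᵀ *ᵥ x) := by
    rw [mulVec_mulVec, Matrix.nonsing_inv_mul _ (by simpa using hdet), one_mulVec]
  have h2 : ‖x‖ ≤ b * ‖Bᵀ *ᵥ x‖ := by
    calc ‖x‖ = ‖(Bᵀ)⁻¹ *ᵥ (Bᵀ *ᵥ x)‖ := by rw [← h1]
      _ ≤ _ := mulVec_norm_le _ _
      _ ≤ _ := by gcongr; linarith
  have h3 : x ⬝ᵥ M *ᵥ x = (Bᵀ *ᵥ x) ⬝ᵥ (Bᵀ *ᵥ x) := by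
    rw [← hB, ← mulVec_mulVec, dotProduct_mulVec, mulVec_transpose]
  have h4 : ∀ w : Fin d → ℝ, ‖w‖ ^ 2 ≤ w ⬝ᵥ w := fun w => by
    have h0 : 0 ≤ w ⬝ᵥ w := Finset.sum_nonneg fun i _ => mul_self_nonneg (w i)
    have : ‖w‖ ≤ Real.sqrt (w ⬝ᵥ w) := by
      rw [pi_norm_le_iff_of_nonneg (Real.sqrt_nonneg _)]
      intro i
      rw [Real.norm_eq_abs]
      apply Real.abs_le_sqrt
      rw [pow_two]
      exact Finset.single_le_sum (f := fun i => w i * w i) (fun i _ => mul_self_nonneg _) (Finset.mem_univ i)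
    calc ‖w‖ ^ 2 ≤ Real.sqrt (w ⬝ᵥ w) ^ 2 := by gcongr
      _ = _ := Real.sq_sqrt h0
  rw [h3, inv_mul_le_iff₀ (by positivity)]
  calc ‖x‖ ^ 2 ≤ (b * ‖Bᵀ *ᵥ x‖) ^ 2 := by gcongr
    _ = b ^ 2 * ‖Bᵀ *ᵥ x‖ ^ 2 := by ring
    _ ≤ _ := by gcongr; exact h4 _

lemma matB_le {d : ℕ} (v : Fin d → Fin d → ℝ) : matB (Matrix.of v) ≤ d ^ 2 * ‖v‖ := by
  unfold matB
  calc ∑ i, ∑ j, |(Matrix.of v) i j| ≤ ∑ i : Fin d, ∑ j : Fin d, ‖v‖ := by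
        refine Finset.sum_le_sum fun i _ => Finset.sum_le_sum fun j _ => ?_
        exact (norm_le_pi_norm (v i) j).trans (norm_le_pi_norm v i)
    _ = _ := by simp; ring

lemma posDef_pert {d : ℕ} {M : Matrix (Fin d) (Fin d) ℝ} (hM : M.PosDef) :
    ∃ ε : ℝ, 0 < ε ∧ ∀ v : Fin d → Fin d → ℝ, (Matrix.of v).IsHermitian → ‖v‖ ≤ ε →
      (M + Matrix.of v).PosDef := by
  obtain ⟨c, hc, h⟩ := posDef_lower hM
  refine ⟨c / (2 * (d ^ 2 + 1)), by positivity, fun v hv hve => ?_⟩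
  refine Matrix.PosDef.of_dotProduct_mulVec_pos (hM.1.add hv) fun x hx => ?_
  rw [star_trivial, add_mulVec, dotProduct_add]
  have h1 := h x
  have h2 := bil_bound (Matrix.of v) x x
  have h3 := matB_le v
  have hx' : 0 < ‖x‖ := norm_pos_iff.2 hx
  have h4 : matB (Matrix.of v) ≤ c / 2 := by
    refine h3.trans ?_
    calc (d:ℝ) ^ 2 * ‖v‖ ≤ (d ^ 2 + 1) * (c / (2 * (d ^ 2 + 1))) := by gcongr; linarith
      _ = c / 2 := by field_simp
  have h5 : matB (Matrix.of v) * ‖x‖ * ‖x‖ ≤ c / 2 * ‖x‖ * ‖x‖ := by gcongr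
  have h6 := neg_abs_le (x ⬝ᵥ (Matrix.of v) *ᵥ x)
  have h7 : 0 < c * ‖x‖ ^ 2 := by positivity
  nlinarith

lemma density_ratio {d : ℕ} {M N : Matrix (Fin d) (Fin d) ℝ} (hM : M.PosDef) (hN : N.PosDef)
    (x : Fin d → ℝ) :
    gaussDensity N x / gaussDensity M x = Real.exp (-(1/2) * (Real.log N.det - Real.log M.det) -
      (1/2) * ∑ i, ∑ j, x i * x j * (N⁻¹ i j - M⁻¹ i j)) := by
  have key : ∀ {N : Matrix (Fin d) (Fin d) ℝ}, N.PosDef → gaussDensity N x =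
      (Real.sqrt ((2 * Real.pi) ^ d))⁻¹ * Real.exp (-(1/2) * Real.log N.det - (1/2) *
        ∑ i, ∑ j, x i * x j * N⁻¹ i j) := by
    intro N hN
    have hd := hN.det_pos
    unfold gaussDensity
    rw [Real.sqrt_mul (by positivity), mul_inv, mul_assoc]
    congr 1
    have : (Real.sqrt N.det)⁻¹ = Real.exp (-(1/2) * Real.log N.det) := by
      rw [show -(1/2) * Real.log N.det = -(Real.log N.det / 2) by ring, ← Real.log_sqrt hd.le,
        Real.exp_neg, Real.exp_log (Real.sqrt_pos.2 hd)]
    rw [this, ← Real.exp_add]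
    congr 1
    have : x ⬝ᵥ N⁻¹ *ᵥ x = ∑ i, ∑ j, x i * x j * N⁻¹ i j := by
      simp only [dotProduct, mulVec, Finset.mul_sum]
      refine Finset.sum_congr rfl fun i _ => Finset.sum_congr rfl fun j _ => by ring
    rw [this]; ring
  rw [key hM, key hN, mul_div_mul_left _ _ (by positivity), ← Real.exp_sub]
  congr 1
  simp only [mul_sub, Finset.sum_sub_distrib]
  ring

lemma ratio_est {d : ℕ} {M : Matrix (Fin d) (Fin d) ℝ} (hM : M.PosDef) {c : ℝ} (hc : 0 < c) :
    ∃ (ε C : ℝ) (Λ : (Fin d → ℝ) → ((Fin d → Fin d → ℝ) →L[ℝ] ℝ)), 0 < ε ∧ 0 < C ∧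
      (∀ x, ‖Λ x‖ ≤ C * Real.exp (c * ‖x‖ ^ 2)) ∧
      ∀ v : Fin d → Fin d → ℝ, (Matrix.of v).IsHermitian → ‖v‖ ≤ ε →
        (M + Matrix.of v).PosDef ∧
        ∀ x, |gaussDensity (M + Matrix.of v) x / gaussDensity M x - 1 - Λ x v| ≤
          C * ‖v‖ ^ 2 * Real.exp (c * ‖x‖ ^ 2) := by
  obtain ⟨ε₀, hε₀, hpos⟩ := posDef_pert hM
  have hentry : ∀ i j, ContDiff ℝ 2 fun v : Fin d → Fin d → ℝ => (M + Matrix.of v) i j := by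
    intro i j
    simp only [Matrix.add_apply, Matrix.of_apply]
    fun_prop
  have hM0 : M + Matrix.of (0 : Fin d → Fin d → ℝ) = M := by
    ext i j; simp
  have hdet0 : (M + Matrix.of (0 : Fin d → Fin d → ℝ)).det ≠ 0 := by
    rw [hM0]; exact hM.det_pos.ne'
  obtain ⟨ε₁, C₁, ℓ, hε₁, hC₁, hℓ⟩ := quad_rem
    (f := fun v : Fin d → Fin d → ℝ => Real.log (M + Matrix.of v).det)
    ((contDiff_det _ hentry).contDiffAt.log hdet0)
  have H := fun i j => quad_rem (contDiffAt_inv_entry _ hentry hdet0 i j)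
  choose ε₂ C₂ m hε₂ hC₂ hm using H
  rw [hM0] at hℓ
  rw [hM0] at hm
  -- common constants
  obtain ⟨ε₃, hε₃, hε₃le⟩ : ∃ ε₃ : ℝ, 0 < ε₃ ∧ ∀ i j, ε₃ ≤ ε₂ i j := by
    have : ∃ e : ℝ, 0 < e ∧ ∀ p : Fin d × Fin d, e ≤ ε₂ p.1 p.2 := by
      rcases isEmpty_or_nonempty (Fin d × Fin d) with h | h
      · exact ⟨1, one_pos, fun p => (h.false p).elim⟩
      · obtain ⟨p, hp⟩ := Finite.exists_min (fun p : Fin d × Fin d => ε₂ p.1 p.2)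
        exact ⟨_, hε₂ p.1 p.2, hp⟩
    obtain ⟨e, he, h⟩ := this
    exact ⟨e, he, fun i j => h (i, j)⟩
  let Λ : (Fin d → ℝ) → ((Fin d → Fin d → ℝ) →L[ℝ] ℝ) := fun x =>
    (-(1/2 : ℝ)) • ℓ - (1/2 : ℝ) • ∑ i, ∑ j, (x i * x j) • m i j
  set B := C₁ + ∑ i, ∑ j, C₂ i j with hB
  set B' := ‖ℓ‖ + ∑ i, ∑ j, ‖m i j‖ with hB'
  have hB0 : 0 < B := add_pos_of_pos_of_nonneg hC₁
    (Finset.sum_nonneg fun i _ => Finset.sum_nonneg fun j _ => (hC₂ i j).le)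
  have hB'0 : 0 ≤ B' := add_nonneg (norm_nonneg _)
    (Finset.sum_nonneg fun i _ => Finset.sum_nonneg fun j _ => norm_nonneg _)
  have hxx : ∀ (x : Fin d → ℝ) i j, |x i * x j| ≤ 1 + ‖x‖ ^ 2 := fun x i j => by
    rw [abs_mul]
    have h1 : |x i| ≤ ‖x‖ := norm_le_pi_norm x i
    have h2 : |x j| ≤ ‖x‖ := norm_le_pi_norm x j
    nlinarith [abs_nonneg (x i), abs_nonneg (x j), norm_nonneg x]
  have hΛ : ∀ x, ‖Λ x‖ ≤ B' * (1 + ‖x‖ ^ 2) := fun x => by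
    have h1 : ‖∑ i, ∑ j, (x i * x j) • m i j‖ ≤ (∑ i, ∑ j, ‖m i j‖) * (1 + ‖x‖ ^ 2) := by
      rw [Finset.sum_mul]
      refine (norm_sum_le _ _).trans (Finset.sum_le_sum fun i _ => ?_)
      rw [Finset.sum_mul]
      refine (norm_sum_le _ _).trans (Finset.sum_le_sum fun j _ => ?_)
      rw [norm_smul, mul_comm]
      gcongr
      exact hxx x i j
    have h2 : ‖Λ x‖ ≤ (1/2) * ‖ℓ‖ + (1/2) * ‖∑ i, ∑ j, (x i * x j) • m i j‖ := by
      refine (norm_sub_le _ _).trans ?_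
      rw [norm_smul, norm_smul]; norm_num
    have h3 : 0 ≤ ‖ℓ‖ * ‖x‖ ^ 2 := by positivity
    have h4 := norm_nonneg ℓ
    have h5 : 0 ≤ ‖∑ i, ∑ j, (x i * x j) • m i j‖ := norm_nonneg _
    rw [hB', add_mul]
    nlinarith
  -- expansion of the exponent
  let q : (Fin d → Fin d → ℝ) → (Fin d → ℝ) → ℝ := fun v x =>
    -(1/2) * (Real.log (M + Matrix.of v).det - Real.log M.det) -
      (1/2) * ∑ i, ∑ j, x i * x j * ((M + Matrix.of v)⁻¹ i j - M⁻¹ i j)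
  have hq : ∀ v x, ‖v‖ ≤ ε₁ → ‖v‖ ≤ ε₃ → |q v x - Λ x v| ≤ B * (1 + ‖x‖ ^ 2) * ‖v‖ ^ 2 := by
    intro v x h1 h3
    have e : q v x - Λ x v = -(1/2) * (Real.log (M + Matrix.of v).det - Real.log M.det - ℓ v) -
      (1/2) * ∑ i, ∑ j, x i * x j * ((M + Matrix.of v)⁻¹ i j - M⁻¹ i j - m i j v) := by
      simp only [q, Λ, ContinuousLinearMap.sub_apply, ContinuousLinearMap.smul_apply,
        ContinuousLinearMap.sum_apply, smul_eq_mul, mul_sub, Finset.sum_sub_distrib]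
      ring
    have h2 : |∑ i, ∑ j, x i * x j * ((M + Matrix.of v)⁻¹ i j - M⁻¹ i j - m i j v)| ≤
        (∑ i, ∑ j, C₂ i j) * ((1 + ‖x‖ ^ 2) * ‖v‖ ^ 2) := by
      rw [Finset.sum_mul]
      refine (Finset.abs_sum_le_sum_abs _ _).trans (Finset.sum_le_sum fun i _ => ?_)
      rw [Finset.sum_mul]
      refine (Finset.abs_sum_le_sum_abs _ _).trans (Finset.sum_le_sum fun j _ => ?_)
      rw [abs_mul]
      calc _ ≤ (1 + ‖x‖ ^ 2) * (C₂ i j * ‖v‖ ^ 2) := by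
            gcongr
            · exact hxx x i j
            · exact hm i j v (h3.trans (hε₃le i j))
        _ = _ := by ring
    have h4 := hℓ v h1
    have h5 : |q v x - Λ x v| ≤ (1/2) * |Real.log (M + Matrix.of v).det - Real.log M.det - ℓ v| +
      (1/2) * |∑ i, ∑ j, x i * x j * ((M + Matrix.of v)⁻¹ i j - M⁻¹ i j - m i j v)| := by
      rw [e]
      refine (abs_sub _ _).trans ?_
      rw [abs_mul, abs_mul]; norm_num
    have h6 : C₁ * ‖v‖ ^ 2 ≤ C₁ * (1 + ‖x‖ ^ 2) * ‖v‖ ^ 2 := by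
      have : 0 ≤ C₁ * ‖x‖ ^ 2 * ‖v‖ ^ 2 := by positivity
      linarith
    have h7 : |∑ i, ∑ j, x i * x j * ((M + Matrix.of v)⁻¹ i j - M⁻¹ i j - m i j v)| ≥ 0 := abs_nonneg _
    have h8 : |Real.log (M + Matrix.of v).det - Real.log M.det - ℓ v| ≥ 0 := abs_nonneg _
    have h9 : B * (1 + ‖x‖ ^ 2) * ‖v‖ ^ 2 = C₁ * (1 + ‖x‖ ^ 2) * ‖v‖ ^ 2 +
      (∑ i, ∑ j, C₂ i j) * ((1 + ‖x‖ ^ 2) * ‖v‖ ^ 2) := by rw [hB]; ring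
    rw [h9]
    linarith
  set D := B + B' with hD
  have hD0 : 0 < D := by linarith
  set ε := min (min ε₀ 1) (min (min ε₁ ε₃) (c / (2 * D))) with hε
  have hεpos : 0 < ε := by positivity
  obtain ⟨C', hC', hexp⟩ := poly_exp_bound 0 (c / 2) le_rfl (by positivity)
  have hexp' : ∀ x : Fin d → ℝ, (1 + ‖x‖ ^ 2) ^ 2 ≤ C' * Real.exp (c / 2 * ‖x‖ ^ 2) := fun x => by
    have h := hexp ‖x‖ (norm_nonneg x)
    rw [zero_mul, Real.exp_zero, mul_one] at h
    refine le_trans ?_ h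
    have : 1 + ‖x‖ ^ 2 ≤ (1 + ‖x‖) ^ 2 := by nlinarith [norm_nonneg x]
    calc (1 + ‖x‖ ^ 2) ^ 2 ≤ ((1 + ‖x‖) ^ 2) ^ 2 := by gcongr
      _ = _ := by ring
  have hexp1 : ∀ x : Fin d → ℝ, (1 + ‖x‖ ^ 2) ≤ C' * Real.exp (c * ‖x‖ ^ 2) := fun x => by
    have h := hexp' x
    have h1 : (1 + ‖x‖ ^ 2) ≤ (1 + ‖x‖ ^ 2) ^ 2 := by nlinarith [sq_nonneg ‖x‖]
    refine h1.trans (h.trans ?_)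
    gcongr
    linarith
  set C := (B' + B) * C' + D ^ 2 * C' * Real.exp (c / 2) with hCdef
  refine ⟨ε, C, Λ, hεpos, by positivity, fun x => ?_, fun v hv hvε => ?_⟩
  · calc ‖Λ x‖ ≤ B' * (1 + ‖x‖ ^ 2) := hΛ x
      _ ≤ B' * (C' * Real.exp (c * ‖x‖ ^ 2)) := by gcongr; exact hexp1 x
      _ = (B' * C') * Real.exp (c * ‖x‖ ^ 2) := by ring
      _ ≤ _ := by
        gcongr
        rw [hCdef]
        have : 0 ≤ B * C' := by positivity
        have : 0 ≤ D ^ 2 * C' * Real.exp (c / 2) := by positivity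
        linarith
  · have hv0 : ‖v‖ ≤ ε₀ := hvε.trans ((min_le_left _ _).trans (min_le_left _ _))
    have hv1 : ‖v‖ ≤ 1 := hvε.trans ((min_le_left _ _).trans (min_le_right _ _))
    have hv2 : ‖v‖ ≤ ε₁ := hvε.trans ((min_le_right _ _).trans ((min_le_left _ _).trans (min_le_left _ _)))
    have hv3 : ‖v‖ ≤ ε₃ := hvε.trans ((min_le_right _ _).trans ((min_le_left _ _).trans (min_le_right _ _)))
    have hv4 : ‖v‖ ≤ c / (2 * D) := hvε.trans ((min_le_right _ _).trans (min_le_right _ _))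
    refine ⟨hpos v hv hv0, fun x => ?_⟩
    rw [density_ratio hM (hpos v hv hv0) x]
    change |Real.exp (q v x) - 1 - Λ x v| ≤ _
    have h1 := hq v x hv2 hv3
    have h2 : |Λ x v| ≤ B' * (1 + ‖x‖ ^ 2) * ‖v‖ := by
      refine ((Λ x).le_opNorm v).trans ?_
      gcongr
      exact hΛ x
    have h3 : |q v x| ≤ D * (1 + ‖x‖ ^ 2) * ‖v‖ := by
      have t : |q v x| ≤ |q v x - Λ x v| + |Λ x v| := by
        have := abs_add_le (q v x - Λ x v) (Λ x v)
        simpa using this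
      have t2 : B * (1 + ‖x‖ ^ 2) * ‖v‖ ^ 2 ≤ B * (1 + ‖x‖ ^ 2) * ‖v‖ := by
        gcongr
        nlinarith [norm_nonneg v]
      calc _ ≤ _ := t
        _ ≤ B * (1 + ‖x‖ ^ 2) * ‖v‖ + B' * (1 + ‖x‖ ^ 2) * ‖v‖ := by linarith
        _ = _ := by rw [hD]; ring
    have h4 : |q v x| ≤ c / 2 * (1 + ‖x‖ ^ 2) := by
      refine h3.trans ?_
      calc D * (1 + ‖x‖ ^ 2) * ‖v‖ ≤ D * (1 + ‖x‖ ^ 2) * (c / (2 * D)) := by gcongr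
        _ = _ := by field_simp
    have h5 : |Real.exp (q v x) - 1 - q v x| ≤
        D ^ 2 * C' * Real.exp (c / 2) * ‖v‖ ^ 2 * Real.exp (c * ‖x‖ ^ 2) := by
      calc _ ≤ q v x ^ 2 * Real.exp |q v x| := abs_exp_sub_one_sub_le _
        _ ≤ (D * (1 + ‖x‖ ^ 2) * ‖v‖) ^ 2 * Real.exp (c / 2 * (1 + ‖x‖ ^ 2)) := by
          rw [← sq_abs]
          gcongr
        _ = (D ^ 2 * ‖v‖ ^ 2 * Real.exp (c / 2 * (1 + ‖x‖ ^ 2))) * (1 + ‖x‖ ^ 2) ^ 2 := by ring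
        _ ≤ (D ^ 2 * ‖v‖ ^ 2 * Real.exp (c / 2 * (1 + ‖x‖ ^ 2))) * (C' * Real.exp (c / 2 * ‖x‖ ^ 2)) := by
          gcongr; exact hexp' x
        _ = D ^ 2 * C' * ‖v‖ ^ 2 * (Real.exp (c / 2 * (1 + ‖x‖ ^ 2)) * Real.exp (c / 2 * ‖x‖ ^ 2)) := by ring
        _ = D ^ 2 * C' * ‖v‖ ^ 2 * (Real.exp (c / 2) * Real.exp (c * ‖x‖ ^ 2)) := by
          rw [← Real.exp_add, ← Real.exp_add]; congr 2; ring
        _ = _ := by ring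
    have h6 : B * (1 + ‖x‖ ^ 2) * ‖v‖ ^ 2 ≤ B * C' * ‖v‖ ^ 2 * Real.exp (c * ‖x‖ ^ 2) := by
      calc _ ≤ B * (C' * Real.exp (c * ‖x‖ ^ 2)) * ‖v‖ ^ 2 := by gcongr; exact hexp1 x
        _ = _ := by ring
    have t : |Real.exp (q v x) - 1 - Λ x v| ≤ |Real.exp (q v x) - 1 - q v x| + |q v x - Λ x v| := by
      have := abs_add_le (Real.exp (q v x) - 1 - q v x) (q v x - Λ x v)
      simpa using this
    have h7 : 0 ≤ B' * C' * ‖v‖ ^ 2 * Real.exp (c * ‖x‖ ^ 2) := by positivity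
    have e : C * ‖v‖ ^ 2 * Real.exp (c * ‖x‖ ^ 2) = B' * C' * ‖v‖ ^ 2 * Real.exp (c * ‖x‖ ^ 2) +
      B * C' * ‖v‖ ^ 2 * Real.exp (c * ‖x‖ ^ 2) +
      D ^ 2 * C' * Real.exp (c / 2) * ‖v‖ ^ 2 * Real.exp (c * ‖x‖ ^ 2) := by rw [hCdef]; ring
    rw [e]
    linarith

open MeasureTheory ProbabilityTheory Matrix
open scoped ENNReal NNReal

lemma psiF_hasFDerivAt {d : ℕ} {M : Matrix (Fin d) (Fin d) ℝ} {φ : (Fin d → ℝ) → ℝ} {C : ℝ}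
    (hC : 0 ≤ C)
    (h2 : ∀ y u, Integrable (fun z => φ (y + z) * (z ⬝ᵥ M⁻¹ *ᵥ u)) (gaussLaw M))
    (h5 : ∀ y u, |psiF M φ (y + u) - psiF M φ y - DF M φ y u| ≤ C * (1 + ‖y‖ ^ 2) * ‖u‖ ^ 2)
    (y : Fin d → ℝ) :
    ∃ L : (Fin d → ℝ) →L[ℝ] ℝ, (∀ u, L u = DF M φ y u) ∧ HasFDerivAt (psiF M φ) L y := by
  let L₀ : (Fin d → ℝ) →ₗ[ℝ] ℝ :=
    { toFun := DF M φ y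
      map_add' := fun u w => by
        unfold DF
        rw [← integral_add (h2 y u) (h2 y w)]
        congr 1; ext z
        rw [mulVec_add, dotProduct_add]; ring
      map_smul' := fun c u => by
        rw [DF_smul]; rfl }
  let L := LinearMap.toContinuousLinearMap L₀
  refine ⟨L, fun u => rfl, ?_⟩
  have hO : (fun x => psiF M φ x - psiF M φ y - L (x - y)) =O[nhds y] fun x => ‖x - y‖ ^ 2 := by
    refine Asymptotics.IsBigO.of_bound (C * (1 + ‖y‖ ^ 2)) (Filter.Eventually.of_forall fun x => ?_)
    have := h5 y (x - y)
    rw [add_sub_cancel] at this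
    rw [Real.norm_eq_abs, Real.norm_eq_abs, abs_of_nonneg (sq_nonneg ‖x - y‖)]
    exact this
  have h0 := hO.hasFDerivAt (𝕜 := ℝ) (by norm_num)
  have h1 : HasFDerivAt (fun x => psiF M φ y + L (x - y)) L y := by
    have := ((L.hasFDerivAt (x := y)).sub_const (L y)).const_add (psiF M φ y)
    simpa only [map_sub] using this
  have := h0.add h1
  rw [zero_add] at this
  refine this.congr_of_eventuallyEq (Filter.Eventually.of_forall fun x => ?_)
  simp

/-- the path rotating `p.1` into `p.2` -/
noncomputable def rotP {d : ℕ} (θ : ℝ) (p : (Fin d → ℝ) × (Fin d → ℝ)) : (Fin d → ℝ) × (Fin d → ℝ) :=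
  (Real.cos θ • p.1 + Real.sin θ • p.2, -Real.sin θ • p.1 + Real.cos θ • p.2)

lemma rotP_neg {d : ℕ} (θ : ℝ) (p : (Fin d → ℝ) × (Fin d → ℝ)) : rotP θ (rotP (-θ) p) = p := by
  unfold rotP
  have h := Real.cos_sq_add_sin_sq θ
  ext i
  · simp
    linear_combination (p.1 i) * h
  · simp
    linear_combination (p.2 i) * h

lemma rotP_meas {d : ℕ} : Measurable fun q : ℝ × ((Fin d → ℝ) × (Fin d → ℝ)) => rotP q.1 q.2 := by
  have : Continuous fun q : ℝ × ((Fin d → ℝ) × (Fin d → ℝ)) => rotP q.1 q.2 := by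
    unfold rotP; fun_prop
  exact this.measurable

lemma rotP_norm1 {d : ℕ} (θ : ℝ) (p : (Fin d → ℝ) × (Fin d → ℝ)) :
    ‖(rotP θ p).1‖ ≤ ‖p.1‖ + ‖p.2‖ := by
  unfold rotP
  refine (norm_add_le _ _).trans ?_
  rw [norm_smul, norm_smul]
  have h1 : ‖Real.cos θ‖ ≤ 1 := Real.abs_cos_le_one θ
  have h2 : ‖Real.sin θ‖ ≤ 1 := Real.abs_sin_le_one θ
  nlinarith [norm_nonneg p.1, norm_nonneg p.2]

lemma rotP_norm2 {d : ℕ} (θ : ℝ) (p : (Fin d → ℝ) × (Fin d → ℝ)) :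
    ‖(rotP θ p).2‖ ≤ ‖p.1‖ + ‖p.2‖ := by
  unfold rotP
  refine (norm_add_le _ _).trans ?_
  rw [norm_smul, norm_smul, norm_neg]
  have h1 : ‖Real.cos θ‖ ≤ 1 := Real.abs_cos_le_one θ
  have h2 : ‖Real.sin θ‖ ≤ 1 := Real.abs_sin_le_one θ
  nlinarith [norm_nonneg p.1, norm_nonneg p.2]

lemma rotP_map {d : ℕ} {M : Matrix (Fin d) (Fin d) ℝ} (hM : M.PosDef) (θ : ℝ) :
    ((gaussLaw M).prod (gaussLaw M)).map (rotP θ) = (gaussLaw M).prod (gaussLaw M) := by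
  have hG := gaussLaw_isGaussian hM
  have := IsGaussian.map_rotation_eq_self (gaussLaw_mean hM) θ
  convert this using 2
  funext p
  exact (ContinuousLinearMap.rotation_apply θ p).symm

lemma rotP_ftc {d : ℕ} {M : Matrix (Fin d) (Fin d) ℝ} (hM : M.PosDef) {φ : (Fin d → ℝ) → ℝ} {C : ℝ}
    (hφ : Measurable φ) (hC : 0 ≤ C)
    (h2 : ∀ y u, Integrable (fun z => φ (y + z) * (z ⬝ᵥ M⁻¹ *ᵥ u)) (gaussLaw M))
    (h4 : ∀ y u, |DF M φ y u| ≤ C * (1 + ‖y‖ ^ 2) * ‖u‖)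
    (h5 : ∀ y u, |psiF M φ (y + u) - psiF M φ y - DF M φ y u| ≤ C * (1 + ‖y‖ ^ 2) * ‖u‖ ^ 2)
    (p : (Fin d → ℝ) × (Fin d → ℝ)) :
    ∫ θ in Set.Ioc 0 (Real.pi / 2), DF M φ (rotP θ p).1 (rotP θ p).2 = psiF M φ p.2 - psiF M φ p.1 := by
  have hd : ∀ θ, HasDerivAt (fun θ => psiF M φ (rotP θ p).1) (DF M φ (rotP θ p).1 (rotP θ p).2) θ := by
    intro θ
    obtain ⟨L, hL, hLd⟩ := psiF_hasFDerivAt hC h2 h5 (rotP θ p).1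
    rw [← hL]
    have h1 : HasDerivAt (fun θ => (rotP θ p).1) (rotP θ p).2 θ := by
      unfold rotP
      exact ((Real.hasDerivAt_cos θ).smul_const p.1).add ((Real.hasDerivAt_sin θ).smul_const p.2)
    exact hLd.comp_hasDerivAt θ h1
  have hm : Measurable fun θ => DF M φ (rotP θ p).1 (rotP θ p).2 := by
    have h1 : Measurable fun θ : ℝ => rotP θ p := by
      have : Continuous fun θ : ℝ => rotP θ p := by unfold rotP; fun_prop
      exact this.measurable
    exact (DF_meas hM hφ).comp h1
  have hb : ∀ θ, |DF M φ (rotP θ p).1 (rotP θ p).2| ≤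
      C * (1 + (‖p.1‖ + ‖p.2‖) ^ 2) * (‖p.1‖ + ‖p.2‖) := fun θ => by
    refine (h4 _ _).trans ?_
    gcongr
    · exact rotP_norm1 θ p
    · exact rotP_norm2 θ p
  have hi : IntervalIntegrable (fun θ => DF M φ (rotP θ p).1 (rotP θ p).2) volume 0 (Real.pi / 2) := by
    rw [intervalIntegrable_iff]
    exact Measure.integrableOn_of_bounded (by simp) hm.aestronglyMeasurable
      (Filter.Eventually.of_forall hb)
  have := intervalIntegral.integral_eq_sub_of_hasDerivAt (fun θ _ => hd θ) hi
  rw [intervalIntegral.integral_of_le (by positivity)] at this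
  rw [this]
  simp [rotP]

open MeasureTheory ProbabilityTheory Matrix
open scoped ENNReal NNReal

noncomputable def wint {d : ℕ} (R : (Fin d → ℝ) → ℝ) (q : (Fin d → ℝ) × (Fin d → ℝ)) : ℝ :=
  ∫ θ in Set.Ioc 0 (Real.pi / 2), R (rotP (-θ) q).1

noncomputable def vF {d : ℕ} (R : (Fin d → ℝ) → ℝ) (q : (Fin d → ℝ) × (Fin d → ℝ)) : Fin d → ℝ :=
  (-(wint R q)) • q.2

noncomputable def gW {d : ℕ} (c : ℝ) (p : (Fin d → ℝ) × (Fin d → ℝ)) : ℝ :=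
  Real.exp (c * (‖p.1‖ ^ 2 + ‖p.2‖ ^ 2))

lemma gW_integrable {d : ℕ} {c : ℝ} {μ : Measure (Fin d → ℝ)} [IsProbabilityMeasure μ]
    (h : Integrable (fun x => Real.exp (c * ‖x‖ ^ 2)) μ) : Integrable (gW c) (μ.prod μ) := by
  refine (h.mul_prod h).congr (Filter.Eventually.of_forall fun p => ?_)
  simp only [gW]
  rw [← Real.exp_add]; congr 1; ring

lemma gW_weight {d : ℕ} {c : ℝ} (hc : 0 < c) : ∃ C : ℝ, 1 ≤ C ∧
    ∀ p : (Fin d → ℝ) × (Fin d → ℝ), (1 + (‖p.1‖ + ‖p.2‖)) ^ 4 ≤ C * gW (c / 2) p := by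
  obtain ⟨C', hC', hexp⟩ := poly_exp_bound 0 (c / 4) le_rfl (by positivity)
  refine ⟨C' + 1, by linarith, fun p => ?_⟩
  have h := hexp (‖p.1‖ + ‖p.2‖) (by positivity)
  rw [zero_mul, Real.exp_zero, mul_one] at h
  refine h.trans ?_
  unfold gW
  refine mul_le_mul (by linarith) (Real.exp_le_exp.2 ?_) (Real.exp_pos _).le (by linarith)
  nlinarith [mul_nonneg hc.le (sq_nonneg (‖p.1‖ - ‖p.2‖))]

lemma gW_mul {d : ℕ} (c : ℝ) (p : (Fin d → ℝ) × (Fin d → ℝ)) : gW (c / 2) p * gW (c / 2) p = gW c p := by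
  unfold gW
  rw [← Real.exp_add]; congr 1; ring

lemma gW_one {d : ℕ} {c : ℝ} (hc : 0 ≤ c) (p : (Fin d → ℝ) × (Fin d → ℝ)) : 1 ≤ gW c p :=
  Real.one_le_exp (by positivity)

lemma gW_pos {d : ℕ} {c : ℝ} (p : (Fin d → ℝ) × (Fin d → ℝ)) : 0 < gW c p := Real.exp_pos _

lemma wint_meas {d : ℕ} {R : (Fin d → ℝ) → ℝ} (hR : Measurable R) : Measurable (wint R) := by
  unfold wint
  refine StronglyMeasurable.measurable ?_
  refine StronglyMeasurable.integral_prod_right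
    (f := fun (q : (Fin d → ℝ) × (Fin d → ℝ)) (θ : ℝ) => R (rotP (-θ) q).1)
    (Measurable.stronglyMeasurable ?_)
  have : Continuous fun q : ((Fin d → ℝ) × (Fin d → ℝ)) × ℝ => (rotP (-q.2) q.1).1 := by
    unfold rotP; fun_prop
  exact hR.comp this.measurable

lemma vF_meas {d : ℕ} {R : (Fin d → ℝ) → ℝ} (hR : Measurable R) : Measurable (vF R) := by
  unfold vF
  exact (wint_meas hR).neg.smul measurable_snd

lemma R_rot_bound {d : ℕ} {R : (Fin d → ℝ) → ℝ} {δ c : ℝ} (hδ : 0 ≤ δ) (hc : 0 < c)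
    (h : ∀ x, |R x| ≤ δ * Real.exp (c / 8 * ‖x‖ ^ 2)) (θ : ℝ) (q : (Fin d → ℝ) × (Fin d → ℝ)) :
    |R (rotP θ q).1| ≤ δ * gW (c / 4) q := by
  refine (h _).trans ?_
  unfold gW
  refine mul_le_mul_of_nonneg_left (Real.exp_le_exp.2 ?_) hδ
  have h1 := rotP_norm1 θ q
  have h2 : ‖(rotP θ q).1‖ ^ 2 ≤ (‖q.1‖ + ‖q.2‖) ^ 2 := by gcongr
  have h3 : ‖(rotP θ q).1‖ ^ 2 ≤ 2 * (‖q.1‖ ^ 2 + ‖q.2‖ ^ 2) := by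
    nlinarith [sq_nonneg (‖q.1‖ - ‖q.2‖)]
  nlinarith

lemma wint_bound {d : ℕ} {R : (Fin d → ℝ) → ℝ} {δ c : ℝ} (hδ : 0 ≤ δ) (hc : 0 < c)
    (h : ∀ x, |R x| ≤ δ * Real.exp (c / 8 * ‖x‖ ^ 2)) (q : (Fin d → ℝ) × (Fin d → ℝ)) :
    |wint R q| ≤ 2 * δ * gW (c / 4) q := by
  unfold wint
  have := norm_setIntegral_le_of_norm_le_const (μ := volume) (s := Set.Ioc 0 (Real.pi / 2))
    (f := fun θ => R (rotP (-θ) q).1) (C := δ * gW (c / 4) q) (by simp)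
    (fun θ _ => R_rot_bound hδ hc h (-θ) q)
  rw [← Real.norm_eq_abs]
  refine this.trans ?_
  have h1 : (volume : Measure ℝ).real (Set.Ioc 0 (Real.pi / 2)) ≤ 2 := by
    rw [Real.volume_real_Ioc_of_le (by positivity)]
    linarith [Real.pi_le_four]
  have h2 : 0 ≤ δ * gW (c / 4) q := mul_nonneg hδ (gW_pos q).le
  nlinarith

lemma vF_bound {d : ℕ} {R : (Fin d → ℝ) → ℝ} {δ c : ℝ} (hδ : 0 ≤ δ) (hc : 0 < c)
    (h : ∀ x, |R x| ≤ δ * Real.exp (c / 8 * ‖x‖ ^ 2)) (q : (Fin d → ℝ) × (Fin d → ℝ)) :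
    ‖vF R q‖ ≤ 2 * δ * gW (c / 4) q * ‖q.2‖ := by
  unfold vF
  rw [norm_smul, norm_neg, Real.norm_eq_abs]
  gcongr
  exact wint_bound hδ hc h q

lemma rot_identity {d : ℕ} {M : Matrix (Fin d) (Fin d) ℝ} (hM : M.PosDef) {φ : (Fin d → ℝ) → ℝ} {C : ℝ}
    (hφ : Measurable φ) (hC : 0 ≤ C)
    (h2 : ∀ y u, Integrable (fun z => φ (y + z) * (z ⬝ᵥ M⁻¹ *ᵥ u)) (gaussLaw M))
    (h3 : ∀ y, |psiF M φ y| ≤ C * (1 + ‖y‖ ^ 2))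
    (h4 : ∀ y u, |DF M φ y u| ≤ C * (1 + ‖y‖ ^ 2) * ‖u‖)
    (h5 : ∀ y u, |psiF M φ (y + u) - psiF M φ y - DF M φ y u| ≤ C * (1 + ‖y‖ ^ 2) * ‖u‖ ^ 2)
    {c δ : ℝ} (hc : 0 < c) (hδ : 0 ≤ δ) (hIntg : Integrable (fun x => Real.exp (c * ‖x‖ ^ 2)) (gaussLaw M))
    {R : (Fin d → ℝ) → ℝ} (hR : Measurable R) (hRb : ∀ x, |R x| ≤ δ * Real.exp (c / 8 * ‖x‖ ^ 2))
    (hR0 : ∫ x, R x ∂(gaussLaw M) = 0) :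
    ∫ q, DF M φ q.1 (vF R q) ∂((gaussLaw M).prod (gaussLaw M)) =
      ∫ x, psiF M φ x * R x ∂(gaussLaw M) := by
  have hG := gaussLaw_isGaussian hM
  set γ := gaussLaw M with hγ
  set ρ := γ.prod γ with hρ
  obtain ⟨C', hC', hW⟩ := gW_weight (d := d) hc
  have hgi : Integrable (gW c) ρ := gW_integrable hIntg
  have hDm : Measurable fun p : (Fin d → ℝ) × (Fin d → ℝ) => DF M φ p.1 p.2 := DF_meas hM hφ
  have hψm : Measurable (psiF M φ) := psiF_meas hM hφ
  have hle : ∀ q : (Fin d → ℝ) × (Fin d → ℝ), gW (c / 4) q ≤ gW (c / 2) q := fun q => by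
    unfold gW; gcongr; linarith
  have hrot0 : ∀ q : (Fin d → ℝ) × (Fin d → ℝ), rotP 0 q = q := fun q => by simp [rotP]
  have hR1 : ∀ q : (Fin d → ℝ) × (Fin d → ℝ), |R q.1| ≤ δ * gW (c / 2) q := fun q => by
    have := R_rot_bound hδ hc hRb 0 q
    rw [hrot0] at this
    exact this.trans (by gcongr; exact hle q)
  have hDrot : ∀ θ q, |DF M φ (rotP θ q).1 (rotP θ q).2| ≤ C * C' * gW (c / 2) q := fun θ q => by
    have hs1 := rotP_norm1 θ q
    have hs2 := rotP_norm2 θ q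
    have hs : 0 ≤ ‖q.1‖ + ‖q.2‖ := by positivity
    calc _ ≤ C * (1 + ‖(rotP θ q).1‖ ^ 2) * ‖(rotP θ q).2‖ := h4 _ _
      _ ≤ C * (1 + (‖q.1‖ + ‖q.2‖) ^ 2) * (‖q.1‖ + ‖q.2‖) := by gcongr
      _ = C * ((1 + (‖q.1‖ + ‖q.2‖) ^ 2) * (‖q.1‖ + ‖q.2‖)) := by ring
      _ ≤ C * (1 + (‖q.1‖ + ‖q.2‖)) ^ 4 := by
        gcongr
        generalize ‖q.1‖ + ‖q.2‖ = s at hs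
        have e1 : 1 + s ^ 2 ≤ (1 + s) ^ 2 := by nlinarith
        have e2 : s ≤ (1 + s) ^ 2 := by nlinarith
        calc (1 + s ^ 2) * s ≤ (1 + s) ^ 2 * (1 + s) ^ 2 := by gcongr
          _ = _ := by ring
      _ ≤ C * (C' * gW (c / 2) q) := by gcongr; exact hW q
      _ = _ := by ring
  set τ := (volume : Measure ℝ).restrict (Set.Ioc 0 (Real.pi / 2)) with hτ
  have hrotc : ∀ ε : ℝ, Continuous fun q : ((Fin d → ℝ) × (Fin d → ℝ)) × ℝ => rotP (ε * q.2) q.1 := by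
    intro ε
    unfold rotP; fun_prop
  -- first Fubini
  have hF1 : Integrable (fun a : ((Fin d → ℝ) × (Fin d → ℝ)) × ℝ =>
      R a.1.1 * DF M φ (rotP a.2 a.1).1 (rotP a.2 a.1).2) (ρ.prod τ) := by
    refine Integrable.mono' ((hgi.const_mul (δ * (C * C'))).comp_fst τ) ?_
      (Filter.Eventually.of_forall fun a => ?_)
    · have h1 := hrotc 1
      simp only [one_mul] at h1
      exact ((hR.comp (measurable_fst.comp measurable_fst)).mul (hDm.comp h1.measurable)).aestronglyMeasurable
    · rw [norm_mul, ← gW_mul]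
      calc _ ≤ (δ * gW (c / 2) a.1) * (C * C' * gW (c / 2) a.1) := by
            gcongr
            · exact mul_nonneg hδ (gW_pos _).le
            · exact hR1 _
            · exact hDrot _ _
        _ = _ := by ring
  have hF2 : Integrable (fun a : ((Fin d → ℝ) × (Fin d → ℝ)) × ℝ =>
      R (rotP (-a.2) a.1).1 * DF M φ a.1.1 a.1.2) (ρ.prod τ) := by
    refine Integrable.mono' ((hgi.const_mul (δ * (C * C'))).comp_fst τ) ?_
      (Filter.Eventually.of_forall fun a => ?_)
    · have h1 := hrotc (-1)
      simp only [neg_mul, one_mul] at h1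
      exact ((hR.comp (measurable_fst.comp h1.measurable)).mul (hDm.comp measurable_fst)).aestronglyMeasurable
    · rw [norm_mul, ← gW_mul]
      have hd0 := hDrot 0 a.1
      rw [hrot0] at hd0
      calc _ ≤ (δ * gW (c / 2) a.1) * (C * C' * gW (c / 2) a.1) := by
            gcongr
            · exact mul_nonneg hδ (gW_pos _).le
            · exact (R_rot_bound hδ hc hRb (-a.2) a.1).trans (by gcongr; exact hle _)
            · exact hd0
        _ = _ := by ring
  have hchange : ∀ θ, ∫ q, R q.1 * DF M φ (rotP θ q).1 (rotP θ q).2 ∂ρ =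
      ∫ q, R (rotP (-θ) q).1 * DF M φ q.1 q.2 ∂ρ := by
    intro θ
    have hmr : ∀ θ, Measurable (rotP (d := d) θ) := fun θ => by
      have : Continuous (rotP (d := d) θ) := by unfold rotP; fun_prop
      exact this.measurable
    conv_lhs => rw [hρ, ← rotP_map hM (-θ)]
    rw [integral_map (hmr _).aemeasurable]
    · simp only [rotP_neg]
      rfl
    · exact ((hR.comp measurable_fst).mul (hDm.comp (hmr θ))).aestronglyMeasurable
  have e1 : ∀ q, DF M φ q.1 (vF R q) = - ∫ θ, R (rotP (-θ) q).1 * DF M φ q.1 q.2 ∂τ := fun q => by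
    rw [integral_mul_const, vF, DF_smul, neg_mul]; rfl
  have hRi : Integrable R γ := by
    refine (hIntg.const_mul δ).mono' hR.aestronglyMeasurable (Filter.Eventually.of_forall fun x => ?_)
    refine (hRb x).trans ?_
    gcongr; linarith
  have hψb : ∀ x, |psiF M φ x| ≤ C * C' * Real.exp (c / 2 * ‖x‖ ^ 2) := fun x => by
    have h := hW (x, 0)
    simp only [gW, norm_zero, add_zero] at h
    have h' : Real.exp (c / 2 * (‖x‖ ^ 2 + 0 ^ 2)) = Real.exp (c / 2 * ‖x‖ ^ 2) := by congr 1; ring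
    rw [h'] at h
    calc _ ≤ C * (1 + ‖x‖ ^ 2) := h3 x
      _ ≤ C * (1 + ‖x‖) ^ 4 := by
        gcongr
        have hx := norm_nonneg x
        generalize ‖x‖ = s at hx
        have e1 : 1 + s ^ 2 ≤ (1 + s) ^ 2 := by nlinarith
        exact e1.trans (pow_le_pow_right₀ (by linarith) (by norm_num))
      _ ≤ C * (C' * Real.exp (c / 2 * ‖x‖ ^ 2)) := by gcongr
      _ = _ := by ring
  have hψi : Integrable (psiF M φ) γ := by
    refine (hIntg.const_mul (C * C')).mono' hψm.aestronglyMeasurable (Filter.Eventually.of_forall fun x => ?_)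
    refine (hψb x).trans ?_
    gcongr; linarith
  have hψRi : Integrable (fun x => psiF M φ x * R x) γ := by
    refine (hIntg.const_mul ((C * C') * δ)).mono' (hψm.mul hR).aestronglyMeasurable
      (Filter.Eventually.of_forall fun x => ?_)
    rw [norm_mul]
    calc _ ≤ (C * C' * Real.exp (c / 2 * ‖x‖ ^ 2)) * (δ * Real.exp (c / 2 * ‖x‖ ^ 2)) := by
          gcongr
          · exact hψb x
          · refine (hRb x).trans ?_
            gcongr; linarith
      _ = C * C' * δ * (Real.exp (c / 2 * ‖x‖ ^ 2) * Real.exp (c / 2 * ‖x‖ ^ 2)) := by ring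
      _ = _ := by rw [← Real.exp_add]; congr 2; ring
  simp only [e1]
  rw [integral_neg, integral_integral_swap (f := fun q θ => R (rotP (-θ) q).1 * DF M φ q.1 q.2) hF2]
  simp only [← hchange]
  rw [← integral_integral_swap (f := fun q θ => R q.1 * DF M φ (rotP θ q).1 (rotP θ q).2) hF1]
  simp only [integral_const_mul, hτ, rotP_ftc hM hφ hC h2 h4 h5]
  simp only [mul_sub]
  rw [integral_sub (hRi.mul_prod hψi)]
  · rw [integral_prod_mul R (psiF M φ), hR0, zero_mul, zero_sub, neg_neg]
    have := integral_fun_fst (μ := γ) (ν := γ) (fun x => R x * psiF M φ x)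
    rw [this]
    simp [mul_comm]
  · have := hψRi.comp_fst γ
    exact this.congr (Filter.Eventually.of_forall fun q => mul_comm _ _)

open MeasureTheory ProbabilityTheory Matrix
open scoped ENNReal NNReal

lemma gaussLaw_conv {d : ℕ} {M N : Matrix (Fin d) (Fin d) ℝ} (hM : M.PosDef) (hN : N.PosDef) :
    ((gaussLaw M).prod (gaussLaw N)).map (fun p => p.1 + p.2) = gaussLaw (M + N) := by
  have h1 := gaussLaw_isGaussian hM
  have h2 := gaussLaw_isGaussian hN
  have h3 := gaussLaw_isGaussian (hM.add hN)
  change (gaussLaw M).conv (gaussLaw N) = _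
  refine Measure.ext_of_charFunDual ?_
  ext L
  rw [charFunDual_conv, gaussLaw_charFunDual hM L _ (dual_dot L), gaussLaw_charFunDual hN L _ (dual_dot L),
    gaussLaw_charFunDual (hM.add hN) L _ (dual_dot L), ← Complex.ofReal_mul, ← Real.exp_add]
  congr 2
  rw [add_mulVec, dotProduct_add]
  ring

set_option maxHeartbeats 1000000 in
lemma core {d : ℕ} {M : Matrix (Fin d) (Fin d) ℝ} (hM : M.PosDef) :
    ∃ c C : ℝ, 0 < c ∧ 0 < C ∧ Integrable (fun x => Real.exp (8 * c * ‖x‖ ^ 2)) (gaussLaw M) ∧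
      (∀ φ : (Fin d → ℝ) → ℝ, Measurable φ → (∀ x, |φ x| ≤ 1 + ‖x‖ ^ 2) →
        Integrable φ (gaussLaw (M + M)) ∧
        (∀ y, Integrable (fun z => φ (y + z)) (gaussLaw M)) ∧
        (∀ y, |psiF M φ y| ≤ C * (1 + ‖y‖ ^ 2)) ∧
        Integrable (psiF M φ) (gaussLaw M) ∧
        ∫ x, φ x ∂(gaussLaw (M + M)) = ∫ y, psiF M φ y ∂(gaussLaw M)) ∧
      ∀ (R : (Fin d → ℝ) → ℝ) (δ : ℝ), 0 ≤ δ → Measurable R →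
        (∀ x, |R x| ≤ δ * Real.exp (c * ‖x‖ ^ 2)) → ∫ x, R x ∂(gaussLaw M) = 0 →
        ∃ π : Measure ((Fin d → ℝ) × (Fin d → ℝ)), IsProbabilityMeasure π ∧
          π.map Prod.fst = gaussLaw (M + M) ∧
          ∫⁻ p, ENNReal.ofReal (‖p.1 - p.2‖ ^ 2) ∂π ≤ ENNReal.ofReal (C * δ ^ 2) ∧
          Integrable (fun x => ‖x‖ ^ 2) (π.map Prod.snd) ∧
          ∀ φ : (Fin d → ℝ) → ℝ, Measurable φ → (∀ x, |φ x| ≤ 1 + ‖x‖ ^ 2) →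
            |∫ x, φ x ∂(π.map Prod.snd) - (∫ x, φ x ∂(gaussLaw (M + M)) +
              ∫ x, psiF M φ x * R x ∂(gaussLaw M))| ≤ C * δ ^ 2 := by
  have hG := gaussLaw_isGaussian hM
  obtain ⟨c, hc, hIntg⟩ := IsGaussian.exists_integrable_exp_sq (gaussLaw M)
  obtain ⟨C, hC, hsm⟩ := smoothing hM
  set γ := gaussLaw M with hγ
  obtain ⟨C', hC', hW⟩ := gW_weight (d := d) hc
  set ρ := γ.prod γ with hρ
  have hgi : Integrable (gW c) ρ := gW_integrable hIntg
  set I := ∫ q, gW c q ∂ρ with hI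
  have hI0 : 0 ≤ I := integral_nonneg fun q => (gW_pos q).le
  -- moments of γ
  have hW1 : ∀ z : Fin d → ℝ, (1 + ‖z‖) ^ 4 ≤ C' * Real.exp (c * ‖z‖ ^ 2) := fun z => by
    have h := hW (z, 0)
    simp only [gW, norm_zero, add_zero] at h
    refine h.trans ?_
    gcongr ?_ * Real.exp ?_
    nlinarith [mul_nonneg hc.le (sq_nonneg ‖z‖)]
  have hz2 : Integrable (fun z : Fin d → ℝ => (1 + ‖z‖) ^ 2) γ := by
    refine (hIntg.const_mul C').mono' (by fun_prop) (Filter.Eventually.of_forall fun z => ?_)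
    rw [Real.norm_eq_abs, abs_of_nonneg (by positivity)]
    exact (pow_le_pow_right₀ (by linarith [norm_nonneg z]) (by norm_num)).trans (hW1 z)
  have hz1 : Integrable (fun z : Fin d → ℝ => 1 + ‖z‖ ^ 2) γ := by
    refine hz2.mono' (by fun_prop) (Filter.Eventually.of_forall fun z => ?_)
    rw [Real.norm_eq_abs, abs_of_nonneg (by positivity)]
    nlinarith [norm_nonneg z]
  have hconv := gaussLaw_conv hM hM
  have first : ∀ φ : (Fin d → ℝ) → ℝ, Measurable φ → (∀ x, |φ x| ≤ 1 + ‖x‖ ^ 2) →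
        Integrable φ (gaussLaw (M + M)) ∧
        Integrable (psiF M φ) γ ∧
        ∫ x, φ x ∂(gaussLaw (M + M)) = ∫ y, psiF M φ y ∂γ := by
    intro φ hφ hφb
    have hi : Integrable (fun p : (Fin d → ℝ) × (Fin d → ℝ) => φ (p.1 + p.2)) (γ.prod γ) := by
      refine ((hz1.mul_prod hz2).const_mul 2).mono'
        (hφ.comp (by fun_prop)).aestronglyMeasurable (Filter.Eventually.of_forall fun p => ?_)
      refine (hφb _).trans ((wt_add p.1 p.2).trans_eq (by ring))
    refine ⟨?_, hi.integral_prod_left, ?_⟩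
    · rw [← hconv, integrable_map_measure hφ.aestronglyMeasurable (by fun_prop)]
      exact hi
    · rw [← hconv, integral_map (by fun_prop) hφ.aestronglyMeasurable, integral_prod _ hi]
      rfl
  set CC := (4 * C' * I + 4 * C * C' * I) + C + 1 with hCC
  refine ⟨c / 8, CC, by positivity, by positivity, ?_, fun φ hφ hφb => ?_, ?_⟩
  · convert hIntg using 5; ring
  · obtain ⟨f1, f2, f3⟩ := first φ hφ hφb
    obtain ⟨s1, -, s3, -, -⟩ := hsm φ hφ hφb
    refine ⟨f1, s1, fun y => (s3 y).trans ?_, f2, f3⟩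
    gcongr
    have : 0 ≤ 4 * C' * I + 4 * C * C' * I := by positivity
    linarith
  intro R δ hδ hR hRb hR0
  have hvm := vF_meas hR
  have hvb := vF_bound hδ hc hRb
  -- pointwise bounds
  have hgsq : ∀ q : (Fin d → ℝ) × (Fin d → ℝ), gW (c / 4) q ^ 2 = gW (c / 2) q := fun q => by
    have := gW_mul (c / 2) q
    rw [show c / 2 / 2 = c / 4 by ring] at this
    rw [pow_two, this]
  have hpt : ∀ q : (Fin d → ℝ) × (Fin d → ℝ), (1 + ‖q.1‖ ^ 2) * ‖vF R q‖ ^ 2 ≤ 4 * C' * δ ^ 2 * gW c q := by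
    intro q
    have h1 : (1 + ‖q.1‖ ^ 2) * ‖q.2‖ ^ 2 ≤ (1 + (‖q.1‖ + ‖q.2‖)) ^ 4 := by
      have ha := norm_nonneg q.1
      have hb := norm_nonneg q.2
      generalize ‖q.1‖ = a at ha
      generalize ‖q.2‖ = b at hb
      have e1 : 1 + a ^ 2 ≤ (1 + (a + b)) ^ 2 := by nlinarith [mul_nonneg ha hb]
      have e2 : b ^ 2 ≤ (1 + (a + b)) ^ 2 := by gcongr; linarith
      calc _ ≤ (1 + (a + b)) ^ 2 * (1 + (a + b)) ^ 2 := by gcongr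
        _ = _ := by ring
    calc _ ≤ (1 + ‖q.1‖ ^ 2) * (2 * δ * gW (c / 4) q * ‖q.2‖) ^ 2 := by gcongr; exact hvb q
      _ = 4 * δ ^ 2 * gW (c / 4) q ^ 2 * ((1 + ‖q.1‖ ^ 2) * ‖q.2‖ ^ 2) := by ring
      _ ≤ 4 * δ ^ 2 * gW (c / 4) q ^ 2 * (C' * gW (c / 2) q) := by
        exact mul_le_mul_of_nonneg_left (h1.trans (hW q)) (by positivity)
      _ = 4 * C' * δ ^ 2 * (gW (c / 2) q * gW (c / 2) q) := by rw [hgsq]; ring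
      _ = _ := by rw [gW_mul]
  have hpt2 : ∀ q : (Fin d → ℝ) × (Fin d → ℝ), ‖vF R q‖ ^ 2 ≤ 4 * C' * δ ^ 2 * gW c q := fun q => by
    refine le_trans ?_ (hpt q)
    exact le_mul_of_one_le_left (by positivity) (by nlinarith [sq_nonneg ‖q.1‖])
  have hv2i : Integrable (fun q => ‖vF R q‖ ^ 2) ρ :=
    (hgi.const_mul (4 * C' * δ ^ 2)).mono' (hvm.norm.pow_const 2).aestronglyMeasurable
      (Filter.Eventually.of_forall fun q => by
        rw [Real.norm_eq_abs, abs_of_nonneg (by positivity)]; exact hpt2 q)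
  have hwv2i : Integrable (fun q : (Fin d → ℝ) × (Fin d → ℝ) => (1 + ‖q.1‖ ^ 2) * ‖vF R q‖ ^ 2) ρ :=
    (hgi.const_mul (4 * C' * δ ^ 2)).mono' (by fun_prop)
      (Filter.Eventually.of_forall fun q => by
        rw [Real.norm_eq_abs, abs_of_nonneg (by positivity)]; exact hpt q)
  have hq1i : Integrable (fun q : (Fin d → ℝ) × (Fin d → ℝ) => 1 + ‖q.1‖ ^ 2) ρ := hz1.comp_fst γ
  -- the map
  set κ := ρ.prod γ with hκ
  let T : ((Fin d → ℝ) × (Fin d → ℝ)) × (Fin d → ℝ) → (Fin d → ℝ) × (Fin d → ℝ) :=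
    fun a => (a.1.1 + a.2, a.1.1 + vF R a.1 + a.2)
  have hT : Measurable T := by fun_prop
  have hS2 : Integrable (fun a : ((Fin d → ℝ) × (Fin d → ℝ)) × (Fin d → ℝ) =>
      1 + ‖a.1.1 + vF R a.1 + a.2‖ ^ 2) κ := by
    have hi1 : Integrable (fun q : (Fin d → ℝ) × (Fin d → ℝ) => 2 * (1 + ‖q.1‖ ^ 2) + 2 * ‖vF R q‖ ^ 2) ρ :=
      (hq1i.const_mul 2).add (hv2i.const_mul 2)
    refine ((hi1.mul_prod hz2).const_mul 2).mono' (by fun_prop) (Filter.Eventually.of_forall fun a => ?_)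
    rw [Real.norm_eq_abs, abs_of_nonneg (by positivity)]
    refine (wt_add _ _).trans ?_
    have h1 : 1 + ‖a.1.1 + vF R a.1‖ ^ 2 ≤ 2 * (1 + ‖a.1.1‖ ^ 2) + 2 * ‖vF R a.1‖ ^ 2 := by
      have h := norm_add_le a.1.1 (vF R a.1)
      have h' : ‖a.1.1 + vF R a.1‖ ^ 2 ≤ (‖a.1.1‖ + ‖vF R a.1‖) ^ 2 := by gcongr
      nlinarith [sq_nonneg (‖a.1.1‖ - ‖vF R a.1‖)]
    rw [← mul_assoc]
    gcongr
  have hsnd : (κ.map T).map Prod.snd = κ.map (fun a => a.1.1 + vF R a.1 + a.2) := by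
    rw [Measure.map_map measurable_snd hT]; rfl
  refine ⟨κ.map T, Measure.isProbabilityMeasure_map hT.aemeasurable, ?_, ?_, ?_, ?_⟩
  · rw [Measure.map_map measurable_fst hT, ← hconv]
    have e : (Prod.fst ∘ T) = (fun p : (Fin d → ℝ) × (Fin d → ℝ) => p.1 + p.2) ∘ (Prod.map Prod.fst id) := rfl
    rw [e, ← Measure.map_map (by fun_prop) (by fun_prop), hκ, ← Measure.map_prod_map _ _ measurable_fst measurable_id]
    rw [hρ]
    simp [hγ]
  · rw [lintegral_map (by fun_prop) hT]
    have e : ∀ a, ENNReal.ofReal (‖(T a).1 - (T a).2‖ ^ 2) = ENNReal.ofReal (‖vF R a.1‖ ^ 2) := fun a => by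
      have : (T a).1 - (T a).2 = - vF R a.1 := by simp only [T]; abel
      rw [this, norm_neg]
    simp only [e]
    have hi : Integrable (fun a : ((Fin d → ℝ) × (Fin d → ℝ)) × (Fin d → ℝ) => ‖vF R a.1‖ ^ 2) κ :=
      hv2i.comp_fst γ
    rw [← ofReal_integral_eq_lintegral_ofReal hi (Filter.Eventually.of_forall fun a => by positivity)]
    apply ENNReal.ofReal_le_ofReal
    have e2 := integral_fun_fst (μ := ρ) (ν := γ) (fun q => ‖vF R q‖ ^ 2)
    rw [hκ, e2]
    simp only [probReal_univ, one_smul]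
    calc ∫ q, ‖vF R q‖ ^ 2 ∂ρ ≤ ∫ q, 4 * C' * δ ^ 2 * gW c q ∂ρ :=
          integral_mono hv2i (hgi.const_mul _) hpt2
      _ = 4 * C' * I * δ ^ 2 := by rw [integral_const_mul, hI]; ring
      _ ≤ CC * δ ^ 2 := by
        gcongr
        have : 0 ≤ 4 * C * C' * I := by positivity
        linarith
  · rw [hsnd, integrable_map_measure (by fun_prop) (by fun_prop)]
    refine hS2.mono' (by fun_prop) (Filter.Eventually.of_forall fun a => ?_)
    simp only [Function.comp_apply]
    rw [Real.norm_eq_abs, abs_of_nonneg (by positivity)]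
    linarith
  · intro φ hφ hφb
    obtain ⟨f1, f2, f3⟩ := first φ hφ hφb
    obtain ⟨s1, s2, s3, s4, s5⟩ := hsm φ hφ hφb
    have hψm : Measurable (psiF M φ) := psiF_meas hM hφ
    have hDm := DF_meas hM hφ
    have hi : Integrable (fun a : ((Fin d → ℝ) × (Fin d → ℝ)) × (Fin d → ℝ) =>
        φ (a.1.1 + vF R a.1 + a.2)) κ :=
      hS2.mono' (hφ.comp (by fun_prop)).aestronglyMeasurable (Filter.Eventually.of_forall fun a => hφb _)
    have e1 : ∫ x, φ x ∂((κ.map T).map Prod.snd) = ∫ q, psiF M φ (q.1 + vF R q) ∂ρ := by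
      rw [hsnd, integral_map (by fun_prop) hφ.aestronglyMeasurable, hκ, integral_prod _ hi]
      rfl
    have e2 : ∫ y, psiF M φ y ∂γ = ∫ q, psiF M φ q.1 ∂ρ := by
      have := integral_fun_fst (μ := γ) (ν := γ) (psiF M φ)
      rw [hρ, this]; simp
    have e3 := rot_identity hM hφ hC.le s2 s3 s4 s5 hc hδ hIntg hR hRb hR0
    rw [e1, f3, e2, ← e3]
    have i1 : Integrable (fun q : (Fin d → ℝ) × (Fin d → ℝ) => psiF M φ (q.1 + vF R q)) ρ :=
      hi.integral_prod_left
    have i2 : Integrable (fun q : (Fin d → ℝ) × (Fin d → ℝ) => psiF M φ q.1) ρ := f2.comp_fst γ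
    have i3 : Integrable (fun q : (Fin d → ℝ) × (Fin d → ℝ) => DF M φ q.1 (vF R q)) ρ := by
      refine ((hq1i.add hwv2i).const_mul C).mono' ?_ (Filter.Eventually.of_forall fun q => ?_)
      · exact (hDm.comp (measurable_fst.prodMk hvm)).aestronglyMeasurable
      · refine (s4 _ _).trans ?_
        simp only [Pi.add_apply]
        have : ‖vF R q‖ ≤ 1 + ‖vF R q‖ ^ 2 := by nlinarith [sq_nonneg (‖vF R q‖ - 1), norm_nonneg (vF R q)]
        calc C * (1 + ‖q.1‖ ^ 2) * ‖vF R q‖ ≤ C * (1 + ‖q.1‖ ^ 2) * (1 + ‖vF R q‖ ^ 2) := by gcongr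
          _ = _ := by ring
    rw [← integral_add i2 i3, ← integral_sub i1 (by exact i2.add i3), ← Real.norm_eq_abs]
    refine (norm_integral_le_of_norm_le (hwv2i.const_mul C) (Filter.Eventually.of_forall fun q => ?_)).trans ?_
    · rw [Real.norm_eq_abs, ← sub_sub, ← mul_assoc]
      exact s5 _ _
    · rw [integral_const_mul]
      have : ∫ q : (Fin d → ℝ) × (Fin d → ℝ), (1 + ‖q.1‖ ^ 2) * ‖vF R q‖ ^ 2 ∂ρ ≤ 4 * C' * δ ^ 2 * I := by
        rw [hI, ← integral_const_mul]
        exact integral_mono hwv2i (hgi.const_mul _) hpt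
      calc _ ≤ C * (4 * C' * δ ^ 2 * I) := by gcongr
        _ = (4 * C * C' * I) * δ ^ 2 := by ring
        _ ≤ CC * δ ^ 2 := by
          gcongr
          have : 0 ≤ 4 * C' * I := by positivity
          linarith

open MeasureTheory ProbabilityTheory Matrix
open scoped ENNReal NNReal

lemma cg_setIntegral {Ω : Type*} {m mΩ : MeasurableSpace Ω} {P : Measure Ω} [IsProbabilityMeasure P]
    {d : ℕ} {F : Ω → Fin d → ℝ} (hm : m ≤ mΩ)
    {A : Ω → Matrix (Fin d) (Fin d) ℝ} (h : CondGaussian P F m A) {s : Set Ω}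
    (hs : MeasurableSet[m] s) (y : Fin d → ℝ) :
    Integrable (fun ω => Complex.exp (Complex.I * ((y ⬝ᵥ F ω : ℝ) : ℂ))) P ∧
    ∫ ω in s, Complex.exp (Complex.I * ((y ⬝ᵥ F ω : ℝ) : ℂ)) ∂P =
      ∫ ω in s, ((Real.exp (-(1/2) * (y ⬝ᵥ (A ω).mulVec y)) : ℝ) : ℂ) ∂P := by
  obtain ⟨hF, -, -, -, hc⟩ := h
  have hFm : AEMeasurable F P := hF.1.aemeasurable
  have hi : Integrable (fun ω => Complex.exp (Complex.I * ((y ⬝ᵥ F ω : ℝ) : ℂ))) P := by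
    refine Integrable.of_bound (C := 1) ?_ (Filter.Eventually.of_forall fun ω => ?_)
    · have : Continuous fun x : Fin d → ℝ => Complex.exp (Complex.I * ((y ⬝ᵥ x : ℝ) : ℂ)) := by
        unfold dotProduct; fun_prop
      exact (this.measurable.comp_aemeasurable hFm).aestronglyMeasurable
    · rw [mul_comm, Complex.norm_exp_ofReal_mul_I]
  refine ⟨hi, ?_⟩
  rw [← setIntegral_condExp hm hi hs]
  refine setIntegral_congr_ae (hm _ hs) ?_
  filter_upwards [hc y] with ω hω _ using hω

lemma cg_second_moment {Ω : Type*} {m mΩ : MeasurableSpace Ω} {P : Measure Ω} [IsProbabilityMeasure P]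
    {d : ℕ} {F : Ω → Fin d → ℝ} (hm : m ≤ mΩ)
    {A : Ω → Matrix (Fin d) (Fin d) ℝ} (h : CondGaussian P F m A) {s : Set Ω}
    (hs : MeasurableSet[m] s) (i : Fin d) (hA : Integrable (fun ω => A ω i i) P) :
    ∫⁻ ω in s, ENNReal.ofReal (F ω i ^ 2) ∂P ≤ ENNReal.ofReal (3 * ∫ ω in s, A ω i i ∂P) := by
  have hFm : AEMeasurable F P := h.1.1.aemeasurable
  have hFi : AEMeasurable (fun ω => F ω i) P := (measurable_pi_apply i).comp_aemeasurable hFm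
  have hA0 : ∀ ω, 0 ≤ A ω i i := fun ω => (h.2.2.1 ω).diag_nonneg
  have key : ∀ t : ℝ, 0 < t → ∫ ω in s, (1 - Real.cos (t * F ω i)) ∂P ≤ t ^ 2 / 2 * ∫ ω in s, A ω i i ∂P := by
    intro t ht
    obtain ⟨hi, he⟩ := cg_setIntegral hm h hs (t • Pi.single i 1)
    have hdot : ∀ x : Fin d → ℝ, (t • Pi.single i (1:ℝ)) ⬝ᵥ x = t * x i := fun x => by simp
    have hq : ∀ ω, (t • Pi.single i (1:ℝ)) ⬝ᵥ (A ω).mulVec (t • Pi.single i (1:ℝ)) = t ^ 2 * A ω i i := fun ω => by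
      rw [hdot, mulVec_smul]
      simp
      ring
    simp only [hq] at he
    simp only [hdot] at he hi
    have hre := congrArg Complex.re he
    rw [integral_complex_ofReal, Complex.ofReal_re] at hre
    have e1 : (∫ ω in s, Complex.exp (Complex.I * ((t * F ω i : ℝ) : ℂ)) ∂P).re =
        ∫ ω in s, Real.cos (t * F ω i) ∂P := by
      have := integral_re (𝕜 := ℂ) hi.integrableOn (μ := P.restrict s)
      simp only [RCLike.re_to_complex] at this
      rw [← this]
      congr 1; ext ω
      rw [mul_comm, Complex.exp_ofReal_mul_I_re]
    rw [e1] at hre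
    have hcosi : Integrable (fun ω => Real.cos (t * F ω i)) P := by
      refine Integrable.of_bound (C := 1) ?_ (Filter.Eventually.of_forall fun ω => Real.abs_cos_le_one _)
      exact (Real.measurable_cos.comp_aemeasurable (hFi.const_mul t)).aestronglyMeasurable
    have hexpi : Integrable (fun ω => Real.exp (-(1/2) * (t ^ 2 * A ω i i))) P := by
      refine Integrable.of_bound (C := 1) ?_ (Filter.Eventually.of_forall fun ω => ?_)
      · exact (Real.measurable_exp.comp_aemeasurable ((hA.1.aemeasurable.const_mul _).const_mul _)).aestronglyMeasurable
      · rw [Real.norm_eq_abs, abs_of_pos (Real.exp_pos _), Real.exp_le_one_iff]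
        have := mul_nonneg (sq_nonneg t) (hA0 ω)
        linarith
    rw [integral_sub (integrable_const _) hcosi.integrableOn, hre,
      ← integral_sub (integrable_const _) hexpi.integrableOn, ← integral_const_mul]
    refine integral_mono ((integrable_const _).sub hexpi.integrableOn) (hA.integrableOn.const_mul _) fun ω => ?_
    have := Real.add_one_le_exp (-(1/2) * (t ^ 2 * A ω i i))
    simp only
    linarith
  let f : ℕ → Ω → ℝ≥0∞ := fun n ω =>
    ENNReal.ofReal (Real.pi ^ 2 / 2 * (n + 1 : ℝ) ^ 2 * (1 - Real.cos ((1 / (n + 1 : ℝ)) * F ω i)))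
  have hle : ∀ ω, ENNReal.ofReal (F ω i ^ 2) ≤ Filter.liminf (fun n => f n ω) Filter.atTop := by
    intro ω
    refine Filter.le_liminf_of_le (by isBoundedDefault) ?_
    obtain ⟨N, hN⟩ := exists_nat_ge |F ω i|
    filter_upwards [Filter.eventually_ge_atTop N] with n hn
    apply ENNReal.ofReal_le_ofReal
    have hn1 : (0:ℝ) < n + 1 := by positivity
    have hn2 : |F ω i| ≤ n + 1 := by
      have : (N : ℝ) ≤ n := by exact_mod_cast hn
      linarith
    have hx : |1 / (n + 1 : ℝ) * F ω i| ≤ Real.pi := by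
      rw [abs_mul, abs_of_pos (by positivity), one_div, inv_mul_le_iff₀ hn1]
      nlinarith [Real.pi_gt_three]
    have hcos := Real.cos_le_one_sub_mul_cos_sq hx
    have hpi := Real.pi_pos
    have : F ω i ^ 2 = Real.pi ^ 2 / 2 * (n + 1 : ℝ) ^ 2 * (2 / Real.pi ^ 2 * (1 / (n + 1 : ℝ) * F ω i) ^ 2) := by
      field_simp
    rw [this]
    gcongr
    linarith
  calc ∫⁻ ω in s, ENNReal.ofReal (F ω i ^ 2) ∂P ≤ ∫⁻ ω in s, Filter.liminf (fun n => f n ω) Filter.atTop ∂P :=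
        lintegral_mono hle
    _ ≤ Filter.liminf (fun n => ∫⁻ ω in s, f n ω ∂P) Filter.atTop := by
        refine lintegral_liminf_le' fun n => ?_
        refine AEMeasurable.ennreal_ofReal ?_
        exact ((aemeasurable_const.sub (Real.measurable_cos.comp_aemeasurable
          (hFi.restrict.const_mul _))).const_mul _)
    _ ≤ ENNReal.ofReal (3 * ∫ ω in s, A ω i i ∂P) := by
        refine Filter.liminf_le_of_frequently_le' (Filter.Frequently.of_forall fun n => ?_)
        have hn1 : (0:ℝ) < n + 1 := by positivity
        have hi : Integrable (fun ω => Real.pi ^ 2 / 2 * (n + 1 : ℝ) ^ 2 *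
            (1 - Real.cos ((1 / (n + 1 : ℝ)) * F ω i))) (P.restrict s) := by
          refine Integrable.const_mul (Integrable.sub (integrable_const _) ?_) _
          refine Integrable.of_bound (C := 1) ?_ (Filter.Eventually.of_forall fun ω => Real.abs_cos_le_one _)
          exact (Real.measurable_cos.comp_aemeasurable (hFi.restrict.const_mul _)).aestronglyMeasurable
        rw [← ofReal_integral_eq_lintegral_ofReal hi (Filter.Eventually.of_forall fun ω => by
          have := Real.cos_le_one ((1 / (n + 1 : ℝ)) * F ω i)
          exact mul_nonneg (by positivity) (by linarith))]
        apply ENNReal.ofReal_le_ofReal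
        rw [integral_const_mul]
        have hk := key (1 / (n + 1 : ℝ)) (by positivity)
        have hI0 : 0 ≤ ∫ ω in s, A ω i i ∂P := integral_nonneg fun ω => hA0 ω
        have hpi2 : Real.pi ^ 2 ≤ 12 := by nlinarith [Real.pi_lt_d2, Real.pi_pos]
        calc _ ≤ Real.pi ^ 2 / 2 * (n + 1 : ℝ) ^ 2 * ((1 / (n + 1 : ℝ)) ^ 2 / 2 * ∫ ω in s, A ω i i ∂P) := by
              gcongr
          _ = Real.pi ^ 2 / 4 * ∫ ω in s, A ω i i ∂P := by field_simp; ring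
          _ ≤ _ := by gcongr; linarith

open MeasureTheory ProbabilityTheory Matrix
open scoped ENNReal NNReal

lemma gaussDensity_nonneg {d : ℕ} (M : Matrix (Fin d) (Fin d) ℝ) (x : Fin d → ℝ) :
    0 ≤ gaussDensity M x := by
  unfold gaussDensity; positivity

lemma gd_joint {d : ℕ} (M : Matrix (Fin d) (Fin d) ℝ) :
    Measurable (fun p : (Fin d → Fin d → ℝ) × (Fin d → ℝ) =>
      gaussDensity (M + Matrix.of p.1) p.2) := by
  have hc : Continuous (fun p : (Fin d → Fin d → ℝ) × (Fin d → ℝ) => (M + Matrix.of p.1 : Matrix (Fin d) (Fin d) ℝ)) := by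
    refine continuous_matrix fun i j => ?_
    simp only [Matrix.add_apply, Matrix.of_apply]
    fun_prop
  have hdet := hc.matrix_det.measurable
  have hinv : ∀ i j, Measurable (fun p : (Fin d → Fin d → ℝ) × (Fin d → ℝ) => (M + Matrix.of p.1 : Matrix (Fin d) (Fin d) ℝ)⁻¹ i j) := by
    intro i j
    simp only [Matrix.inv_def, Matrix.smul_apply, Ring.inverse_eq_inv', smul_eq_mul]
    exact hdet.inv.mul (hc.matrix_adjugate.matrix_elem i j).measurable
  unfold gaussDensity dotProduct mulVec dotProduct
  refine Measurable.mul ?_ ?_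
  · exact (Real.continuous_sqrt.measurable.comp (hdet.const_mul _)).inv
  · refine Real.measurable_exp.comp (Measurable.const_mul ?_ _)
    refine Finset.measurable_sum _ fun i _ => Measurable.mul ?_ ?_
    · exact (measurable_pi_apply i).comp measurable_snd
    · refine Finset.measurable_sum _ fun j _ => Measurable.mul (hinv i j) ?_
      exact (measurable_pi_apply j).comp measurable_snd

lemma gaussLaw_integral_C {d : ℕ} {M : Matrix (Fin d) (Fin d) ℝ} (f : (Fin d → ℝ) → ℂ) :
    ∫ x, f x ∂gaussLaw M = ∫ x, (gaussDensity M x : ℂ) * f x := by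
  unfold gaussLaw
  rw [integral_withDensity_eq_integral_toReal_smul (gaussDensity_meas M).ennreal_ofReal
    (Filter.Eventually.of_forall fun _ => ENNReal.ofReal_lt_top)]
  congr 1; ext x
  rw [ENNReal.toReal_ofReal (gaussDensity_nonneg M x), Complex.real_smul]

set_option maxHeartbeats 2000000 in
lemma good_law {Ω : Type*} {m mΩ : MeasurableSpace Ω} {P : Measure Ω} [IsProbabilityMeasure P]
    {d : ℕ} {F : Ω → Fin d → ℝ} (hm : m ≤ mΩ)
    {A : Ω → Matrix (Fin d) (Fin d) ℝ} (h : CondGaussian P F m A) {s : Set Ω}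
    (hs : MeasurableSet[m] s) {M : Matrix (Fin d) (Fin d) ℝ} (hM : M.PosDef)
    (Δ : Ω → Fin d → Fin d → ℝ) (hΔ : Measurable Δ)
    (hA : ∀ ω, A ω = M + (M + Matrix.of (Δ ω)))
    (hpd : ∀ ω ∈ s, (M + Matrix.of (Δ ω)).PosDef) (w : (Fin d → ℝ) → ℝ)
    (hw : Integrable w (gaussLaw M)) 
    (hb : ∀ ω ∈ s, ∀ x, gaussDensity (M + Matrix.of (Δ ω)) x / gaussDensity M x ≤ w x) :
    Measurable (fun x => ∫ ω in s, gaussDensity (M + Matrix.of (Δ ω)) x / gaussDensity M x ∂P) ∧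
    Integrable (fun x => ∫ ω in s, gaussDensity (M + Matrix.of (Δ ω)) x / gaussDensity M x ∂P) (gaussLaw M) ∧
    (∀ φ : (Fin d → ℝ) → ℝ, Measurable φ → Integrable (fun ω => φ (F ω)) (P.restrict s) →
      ∫ ω in s, φ (F ω) ∂P = ∫ x, psiF M φ x *
        (∫ ω in s, gaussDensity (M + Matrix.of (Δ ω)) x / gaussDensity M x ∂P) ∂gaussLaw M) := by
  have hs' : MeasurableSet s := hm _ hs
  have hFm : AEMeasurable F P := h.1.1.aemeasurable
  have : IsGaussian (gaussLaw M) := gaussLaw_isGaussian hM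
  set r : Ω → (Fin d → ℝ) → ℝ := fun ω x => gaussDensity (M + Matrix.of (Δ ω)) x / gaussDensity M x with hr
  have hr0 : ∀ ω x, 0 ≤ r ω x := fun ω x => div_nonneg (gaussDensity_nonneg _ _) (gaussDensity_nonneg _ _)
  have hrm : Measurable (fun p : Ω × (Fin d → ℝ) => r p.1 p.2) := by
    have h1 := (gd_joint M).comp ((hΔ.comp measurable_fst).prodMk (measurable_snd (α := Ω) (β := Fin d → ℝ)))
    have h2 : Measurable (fun p : Ω × (Fin d → ℝ) => gaussDensity M p.2) :=
      (gaussDensity_meas M).comp measurable_snd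
    exact h1.div h2
  have hrm' : Measurable (fun p : (Fin d → ℝ) × Ω => r p.2 p.1) := hrm.comp measurable_swap
  have hsae : ∀ᵐ ω ∂(P.restrict s), ω ∈ s := ae_restrict_mem hs'
  have hprod : ∀ᵐ p ∂((P.restrict s).prod (gaussLaw M)), p.1 ∈ s :=
    Measure.quasiMeasurePreserving_fst.ae hsae
  have hri : Integrable (fun p : Ω × (Fin d → ℝ) => r p.1 p.2) ((P.restrict s).prod (gaussLaw M)) := by
    refine Integrable.mono' (hw.comp_snd (P.restrict s)) hrm.aestronglyMeasurable ?_
    filter_upwards [hprod] with p hp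
    rw [Real.norm_eq_abs, abs_of_nonneg (hr0 _ _)]
    exact hb _ hp _
  set R : (Fin d → ℝ) → ℝ := fun x => ∫ ω in s, r ω x ∂P with hR
  have hRm : Measurable R := (hrm'.stronglyMeasurable.integral_prod_right (ν := P.restrict s)).measurable
  have hR0 : ∀ x, 0 ≤ R x := fun x => integral_nonneg fun ω => hr0 ω x
  have hRi : Integrable R (gaussLaw M) := hri.integral_prod_right
  refine ⟨hRm, hRi, ?_⟩
  set μ' := (gaussLaw M).withDensity (fun x => ENNReal.ofReal (R x)) with hμ'
  have : IsFiniteMeasure μ' := isFiniteMeasure_withDensity_ofReal hRi.2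
  have hlaw : (P.restrict s).map F = μ'.conv (gaussLaw M) := by
    have hFs : AEMeasurable F (P.restrict s) := hFm.restrict
    refine Measure.ext_of_charFunDual ?_
    ext L
    rw [charFunDual_conv]
    set y := (fun i => L (Pi.single i (1:ℝ))) with hy
    have hL : ∀ x, L x = y ⬝ᵥ x := dual_dot L
    rw [gaussLaw_charFunDual hM L y hL]
    have hcont : Continuous (fun x => Complex.exp (L x * Complex.I)) := by fun_prop
    have e1 : charFunDual ((P.restrict s).map F) L =
        ∫ ω in s, ((Real.exp (-(1/2) * (y ⬝ᵥ (A ω).mulVec y)) : ℝ) : ℂ) ∂P := by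
      rw [charFunDual_apply, integral_map hFs hcont.aestronglyMeasurable,
        ← (cg_setIntegral hm h hs y).2]
      congr 1; ext ω
      rw [hL, mul_comm]
    have e2 : charFunDual μ' L = ∫ x, ∫ ω in s, ((r ω x : ℝ) : ℂ) * Complex.exp (L x * Complex.I) ∂P ∂(gaussLaw M) := by
      rw [charFunDual_apply, hμ', integral_withDensity_eq_integral_toReal_smul hRm.ennreal_ofReal
        (Filter.Eventually.of_forall fun _ => ENNReal.ofReal_lt_top)]
      congr 1; ext x
      rw [ENNReal.toReal_ofReal (hR0 x), Complex.real_smul, integral_mul_const, integral_complex_ofReal]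
    have hIntg : Integrable (fun p : Ω × (Fin d → ℝ) => ((r p.1 p.2 : ℝ) : ℂ) * Complex.exp (L p.2 * Complex.I))
        ((P.restrict s).prod (gaussLaw M)) := by
      refine Integrable.mono' hri ?_ (Filter.Eventually.of_forall fun p => ?_)
      · exact ((Complex.measurable_ofReal.comp hrm).mul (hcont.measurable.comp measurable_snd)).aestronglyMeasurable
      · rw [norm_mul, Complex.norm_exp_ofReal_mul_I, mul_one, Complex.norm_real, Real.norm_eq_abs,
          abs_of_nonneg (hr0 _ _)]
    rw [e1, e2, ← integral_integral_swap hIntg, ← integral_mul_const]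
    refine setIntegral_congr_fun hs' fun ω hω => ?_
    have e3 : ∫ x, ((r ω x : ℝ) : ℂ) * Complex.exp (L x * Complex.I) ∂(gaussLaw M) =
        charFunDual (gaussLaw (M + Matrix.of (Δ ω))) L := by
      rw [charFunDual_apply, gaussLaw_integral_C, gaussLaw_integral_C]
      congr 1; ext x
      have := (gaussDensity_pos hM x).ne'
      rw [← mul_assoc, ← Complex.ofReal_mul, hr]
      simp only
      rw [mul_div_cancel₀ _ this]
    rw [e3, gaussLaw_charFunDual (hpd ω hω) L y hL, ← Complex.ofReal_mul, ← Real.exp_add]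
    rw [hA ω, Matrix.add_mulVec M, dotProduct_add]
    congr 2; ring
  intro φ hφ hφi
  have hFs : AEMeasurable F (P.restrict s) := hFm.restrict
  rw [← integral_map (f := φ) hFs hφ.aestronglyMeasurable]
  have hφi' : Integrable φ ((P.restrict s).map F) := (integrable_map_measure hφ.aestronglyMeasurable hFs).2 hφi
  rw [hlaw] at hφi' ⊢
  unfold Measure.conv at hφi' ⊢
  have hadd : Measurable (fun p : (Fin d → ℝ) × (Fin d → ℝ) => p.1 + p.2) := measurable_fst.add measurable_snd
  rw [integrable_map_measure hφ.aestronglyMeasurable hadd.aemeasurable] at hφi'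
  change Integrable (fun p : (Fin d → ℝ) × (Fin d → ℝ) => φ (p.1 + p.2)) _ at hφi'
  rw [integral_map hadd.aemeasurable hφ.aestronglyMeasurable, integral_prod _ hφi', hμ',
    integral_withDensity_eq_integral_toReal_smul hRm.ennreal_ofReal
        (Filter.Eventually.of_forall fun _ => ENNReal.ofReal_lt_top)]
  congr 1; ext x
  rw [ENNReal.toReal_ofReal (hR0 x), smul_eq_mul, mul_comm]
  rfl

open MeasureTheory ProbabilityTheory Matrix
open scoped ENNReal NNReal

lemma norm_sq_le_sum {d : ℕ} (x : Fin d → ℝ) : ‖x‖ ^ 2 ≤ ∑ i, x i ^ 2 := by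
  have h0 : 0 ≤ ∑ i, x i ^ 2 := Finset.sum_nonneg fun i _ => sq_nonneg _
  have : ‖x‖ ≤ Real.sqrt (∑ i, x i ^ 2) := by
    refine (pi_norm_le_iff_of_nonneg (Real.sqrt_nonneg _)).2 fun i => ?_
    rw [Real.norm_eq_abs]
    exact Real.abs_le_sqrt (Finset.single_le_sum (f := fun i => x i ^ 2) (fun i _ => sq_nonneg _) (Finset.mem_univ i))
  calc ‖x‖ ^ 2 ≤ (Real.sqrt (∑ i, x i ^ 2)) ^ 2 := by gcongr
    _ = _ := Real.sq_sqrt h0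

lemma cg_moment_real {Ω : Type*} {m mΩ : MeasurableSpace Ω} {P : Measure Ω} [IsProbabilityMeasure P]
    {d : ℕ} {F : Ω → Fin d → ℝ} (hm : m ≤ mΩ)
    {A : Ω → Matrix (Fin d) (Fin d) ℝ} (h : CondGaussian P F m A)
    (hA : ∀ i, Integrable (fun ω => A ω i i) P) :
    Integrable (fun ω => ‖F ω‖ ^ 2) P ∧ ∀ s, MeasurableSet[m] s →
      ∫ ω in s, ‖F ω‖ ^ 2 ∂P ≤ ∑ i, 3 * ∫ ω in s, A ω i i ∂P := by
  have hFm : AEMeasurable F P := h.1.1.aemeasurable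
  have hFi : ∀ i, AEMeasurable (fun ω => F ω i) P := fun i => (measurable_pi_apply i).comp_aemeasurable hFm
  have hA0 : ∀ i ω, 0 ≤ A ω i i := fun i ω => (h.2.2.1 ω).diag_nonneg
  have hi : ∀ i, Integrable (fun ω => F ω i ^ 2) P := by
    intro i
    refine ⟨((hFi i).pow_const 2).aestronglyMeasurable, ?_⟩
    rw [hasFiniteIntegral_iff_ofReal (Filter.Eventually.of_forall fun ω => sq_nonneg _)]
    have := cg_second_moment hm h (s := Set.univ) MeasurableSet.univ i (hA i)
    rw [Measure.restrict_univ] at this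
    exact lt_of_le_of_lt this ENNReal.ofReal_lt_top
  have hS : Integrable (fun ω => ∑ i, F ω i ^ 2) P := integrable_finsetSum _ fun i _ => hi i
  have hF : Integrable (fun ω => ‖F ω‖ ^ 2) P := by
    refine hS.mono' (hFm.norm.pow_const 2).aestronglyMeasurable (Filter.Eventually.of_forall fun ω => ?_)
    rw [Real.norm_eq_abs, abs_of_nonneg (by positivity)]
    exact norm_sq_le_sum _
  refine ⟨hF, fun s hs => ?_⟩
  calc ∫ ω in s, ‖F ω‖ ^ 2 ∂P ≤ ∫ ω in s, ∑ i, F ω i ^ 2 ∂P :=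
        integral_mono hF.integrableOn hS.integrableOn fun ω => norm_sq_le_sum _
    _ = ∑ i, ∫ ω in s, F ω i ^ 2 ∂P := integral_finsetSum _ fun i _ => (hi i).integrableOn
    _ ≤ _ := by
      refine Finset.sum_le_sum fun i _ => ?_
      have h0 : 0 ≤ 3 * ∫ ω in s, A ω i i ∂P :=
        mul_nonneg (by norm_num) (integral_nonneg fun ω => hA0 i ω)
      rw [← ENNReal.ofReal_le_ofReal_iff h0, ofReal_integral_eq_lintegral_ofReal (hi i).integrableOn
        (Filter.Eventually.of_forall fun ω => sq_nonneg _)]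
      exact cg_second_moment hm h hs i (hA i)

lemma exp_int {d : ℕ} {M : Matrix (Fin d) (Fin d) ℝ} (hM : M.PosDef) {c : ℝ} (hc : 0 < c)
    (hci : Integrable (fun x : Fin d → ℝ => Real.exp (8 * c * ‖x‖ ^ 2)) (gaussLaw M)) :
    Integrable (fun x : Fin d → ℝ => Real.exp (c * ‖x‖ ^ 2)) (gaussLaw M) ∧
    Integrable (fun x : Fin d → ℝ => 1 + ‖x‖ ^ 2) (gaussLaw M) ∧
    Integrable (fun x : Fin d → ℝ => (1 + ‖x‖ ^ 2) * Real.exp (c * ‖x‖ ^ 2)) (gaussLaw M) := by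
  have hb : ∀ t : ℝ, 0 ≤ t → (1 + t) * Real.exp (c * t) ≤ (1 + 1 / (7 * c)) * Real.exp (8 * c * t) := by
    intro t ht
    have e : Real.exp (8 * c * t) = Real.exp (7 * c * t) * Real.exp (c * t) := by
      rw [← Real.exp_add]; ring_nf
    rw [e, ← mul_assoc]
    gcongr
    have h1 := Real.add_one_le_exp (7 * c * t)
    have h2 : (1 : ℝ) ≤ Real.exp (7 * c * t) := Real.one_le_exp (by positivity)
    have h3 : t ≤ 1 / (7 * c) * Real.exp (7 * c * t) := by
      rw [one_div, ← div_eq_inv_mul, le_div_iff₀ (by positivity)]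
      linarith
    linarith
  have h3 : Integrable (fun x : Fin d → ℝ => (1 + ‖x‖ ^ 2) * Real.exp (c * ‖x‖ ^ 2)) (gaussLaw M) := by
    refine (hci.const_mul (1 + 1 / (7 * c))).mono' (by fun_prop) (Filter.Eventually.of_forall fun x => ?_)
    rw [Real.norm_eq_abs, abs_of_nonneg (by positivity)]
    exact hb _ (by positivity)
  refine ⟨h3.mono' (by fun_prop) (Filter.Eventually.of_forall fun x => ?_),
    h3.mono' (by fun_prop) (Filter.Eventually.of_forall fun x => ?_), h3⟩
  · rw [Real.norm_eq_abs, abs_of_nonneg (by positivity)]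
    have := Real.exp_pos (c * ‖x‖ ^ 2)
    nlinarith [sq_nonneg ‖x‖]
  · rw [Real.norm_eq_abs, abs_of_nonneg (by positivity)]
    have : 1 ≤ Real.exp (c * ‖x‖ ^ 2) := Real.one_le_exp (by positivity)
    nlinarith [sq_nonneg ‖x‖]

set_option maxHeartbeats 4000000 in
lemma prob_side {d : ℕ} {M : Matrix (Fin d) (Fin d) ℝ} (hM : M.PosDef) {c : ℝ} (hc : 0 < c)
    (hci : Integrable (fun x : Fin d → ℝ => Real.exp (8 * c * ‖x‖ ^ 2)) (gaussLaw M))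
    (Cψ : ℝ) (hCψ : 0 < Cψ)
    (H : ∀ φ : (Fin d → ℝ) → ℝ, Measurable φ → (∀ x, |φ x| ≤ 1 + ‖x‖ ^ 2) →
      (∀ y, |psiF M φ y| ≤ Cψ * (1 + ‖y‖ ^ 2)) ∧ Integrable (psiF M φ) (gaussLaw M) ∧
      ∫ x, φ x ∂gaussLaw (M + M) = ∫ x, psiF M φ x ∂gaussLaw M) :
    ∃ C₁ : ℝ, 0 < C₁ ∧ ∀ (Ω : Type) (m mΩ : MeasurableSpace Ω) (_ : m ≤ mΩ) (P : Measure Ω)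
      (_ : IsProbabilityMeasure P) (F : Ω → Fin d → ℝ) (A : Ω → Matrix (Fin d) (Fin d) ℝ)
      (Δ : Ω → Fin d → Fin d → ℝ), CondGaussian P F m A → Measurable[m] Δ →
      (∀ ω, A ω = M + (M + Matrix.of (Δ ω))) → Integrable (fun ω => ‖Δ ω‖ ^ 4) P →
      Integrable (fun ω => ‖F ω‖ ^ 2) P ∧
      ∃ R : (Fin d → ℝ) → ℝ, Measurable R ∧
        (∀ x, |R x| ≤ C₁ * (‖∫ ω, Δ ω ∂P‖ + ∫ ω, ‖Δ ω‖ ^ 2 ∂P) * Real.exp (c * ‖x‖ ^ 2)) ∧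
        ∫ x, R x ∂gaussLaw M = 0 ∧
        ∀ φ : (Fin d → ℝ) → ℝ, Measurable φ → (∀ x, |φ x| ≤ 1 + ‖x‖ ^ 2) →
          |∫ ω, φ (F ω) ∂P - ∫ x, φ x ∂gaussLaw (M + M) - ∫ x, psiF M φ x * R x ∂gaussLaw M|
            ≤ C₁ * ∫ ω, ‖Δ ω‖ ^ 4 ∂P := by
  obtain ⟨ε, C, Λ, hε, hC, hΛ, hratio⟩ := ratio_est hM hc
  obtain ⟨hI1, hI2, hI3⟩ := exp_int hM hc hci
  have hgauss : IsGaussian (gaussLaw M) := gaussLaw_isGaussian hM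
  set J : ℝ := ∫ y : Fin d → ℝ, Cψ * (1 + ‖y‖ ^ 2) ∂gaussLaw M with hJ
  have hJ0 : 0 ≤ J := integral_nonneg fun y => by positivity
  set k : ℝ := ‖(fun i j => (M + M) i j : Fin d → Fin d → ℝ)‖ with hk
  have hk0 : 0 ≤ k := norm_nonneg _
  set Cb : ℝ := (1 + J) / ε ^ 4 + d * (3 * (k / ε ^ 4 + 1 / ε ^ 3)) with hCb
  have hCb0 : 0 < Cb := by positivity
  set Ca : ℝ := C + C / ε with hCa
  have hCa0 : 0 < Ca := by positivity
  have hkle : ∀ i, (M + M) i i ≤ k := fun i =>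
    (le_abs_self _).trans ((norm_le_pi_norm (fun j => (M + M) i j) i).trans
      (norm_le_pi_norm (fun i j => (M + M) i j) i))
  clear_value Ca Cb J k
  refine ⟨Ca + Cb, by positivity, ?_⟩
  intro Ω m mΩ hm P hP F A Δ hcg hΔm hA hi4
  have hΔ : Measurable Δ := hΔm.mono hm le_rfl
  have hΔn : Measurable (fun ω => ‖Δ ω‖) := hΔ.norm
  have hFm : AEMeasurable F P := hcg.1.1.aemeasurable
  have hiΔ : Integrable Δ P := by
    refine Integrable.mono' ((integrable_const (1:ℝ)).add hi4) hΔ.aestronglyMeasurable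
      (Filter.Eventually.of_forall fun ω => ?_)
    simp only [Pi.add_apply]
    nlinarith [sq_nonneg (‖Δ ω‖ ^ 2 - 1), sq_nonneg (‖Δ ω‖ - 1), norm_nonneg (Δ ω)]
  have hi2 : Integrable (fun ω => ‖Δ ω‖ ^ 2) P := by
    refine Integrable.mono' ((integrable_const (1:ℝ)).add hi4) (hΔn.pow_const 2).aestronglyMeasurable
      (Filter.Eventually.of_forall fun ω => ?_)
    simp only [Pi.add_apply]
    rw [Real.norm_eq_abs, abs_of_nonneg (by positivity)]
    nlinarith [sq_nonneg (‖Δ ω‖ ^ 2 - 1), sq_nonneg (‖Δ ω‖ ^ 2)]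
  have hAii : ∀ i ω, A ω i i = (M + M) i i + Δ ω i i := by
    intro i ω
    rw [hA ω, ← add_assoc]; rfl
  have hΔii : ∀ i, Integrable (fun ω => Δ ω i i) P := fun i => (hiΔ.eval i).eval i
  have hAi : ∀ i, Integrable (fun ω => A ω i i) P := by
    intro i
    simp only [hAii]
    exact (integrable_const _).add (hΔii i)
  obtain ⟨hF2, hFs⟩ := cg_moment_real hm hcg hAi
  have hherm : ∀ ω, (Matrix.of (Δ ω)).IsHermitian := by
    intro ω
    have h1 := (hcg.2.2.1 ω).isHermitian
    have h2 := hM.isHermitian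
    have : Matrix.of (Δ ω) = A ω - M - M := by rw [hA ω]; abel
    rw [this]
    exact (h1.sub h2).sub h2
  refine ⟨hF2, ?_⟩
  set s : Set Ω := {ω | ‖Δ ω‖ ≤ ε} with hs
  have hsm : MeasurableSet[m] s := by
    have : Measurable[m] (fun ω => ‖Δ ω‖) := measurable_norm.comp hΔm
    exact this measurableSet_Iic
  have hs' : MeasurableSet s := hm _ hsm
  set w : (Fin d → ℝ) → ℝ := fun x => (1 + C * ε + C * ε ^ 2) * Real.exp (c * ‖x‖ ^ 2) with hw
  have hwi : Integrable w (gaussLaw M) := hI1.const_mul _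
  have hr1 : ∀ x, ∀ ω ∈ s, |gaussDensity (M + Matrix.of (Δ ω)) x / gaussDensity M x - 1 - Λ x (Δ ω)|
      ≤ C * ‖Δ ω‖ ^ 2 * Real.exp (c * ‖x‖ ^ 2) := fun x ω hω => (hratio _ (hherm ω) hω).2 x
  have hb : ∀ ω ∈ s, ∀ x, gaussDensity (M + Matrix.of (Δ ω)) x / gaussDensity M x ≤ w x := by
    intro ω hω x
    have h1 := (abs_le.1 (hr1 x ω hω)).2
    have h2 : Λ x (Δ ω) ≤ C * Real.exp (c * ‖x‖ ^ 2) * ε := by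
      calc Λ x (Δ ω) ≤ ‖Λ x (Δ ω)‖ := le_abs_self _
        _ ≤ ‖Λ x‖ * ‖Δ ω‖ := (Λ x).le_opNorm _
        _ ≤ C * Real.exp (c * ‖x‖ ^ 2) * ε := by
          have := hΛ x
          have hω' : ‖Δ ω‖ ≤ ε := hω
          gcongr
    have h3 : C * ‖Δ ω‖ ^ 2 * Real.exp (c * ‖x‖ ^ 2) ≤ C * ε ^ 2 * Real.exp (c * ‖x‖ ^ 2) := by
      have hω' : ‖Δ ω‖ ≤ ε := hω
      gcongr
    have h4 : 1 ≤ Real.exp (c * ‖x‖ ^ 2) := Real.one_le_exp (by positivity)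
    simp only [hw]
    linarith
  obtain ⟨hRm, hRi, hRφ⟩ := good_law hm hcg hsm hM Δ hΔ hA (fun ω hω => (hratio _ (hherm ω) hω).1) w hwi hb
  have hr0 : ∀ ω x, 0 ≤ gaussDensity (M + Matrix.of (Δ ω)) x / gaussDensity M x := fun ω x =>
    div_nonneg (gaussDensity_nonneg _ _) (gaussDensity_nonneg _ _)
  have hrm : ∀ x, Measurable (fun ω => gaussDensity (M + Matrix.of (Δ ω)) x / gaussDensity M x) := by
    intro x
    exact ((gd_joint M).comp (hΔ.prodMk measurable_const)).div_const _
  have hrmi : ∀ x, Integrable (fun ω => gaussDensity (M + Matrix.of (Δ ω)) x / gaussDensity M x) (P.restrict s) := by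
    intro x
    refine Integrable.of_bound (C := w x) (hrm x).aestronglyMeasurable ?_
    filter_upwards [ae_restrict_mem hs'] with ω hω
    rw [Real.norm_eq_abs, abs_of_nonneg (hr0 _ _)]
    exact hb ω hω x
  set R' : (Fin d → ℝ) → ℝ := fun x => ∫ ω in s, gaussDensity (M + Matrix.of (Δ ω)) x / gaussDensity M x ∂P with hR'
  set p : ℝ := P.real s with hp
  have hp0 : 0 ≤ p := measureReal_nonneg
  have hp1 : p ≤ 1 := measureReal_le_one
  set e1 : ℝ := ‖∫ ω, Δ ω ∂P‖ with he1
  set m2 : ℝ := ∫ ω, ‖Δ ω‖ ^ 2 ∂P with hm2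
  set m4 : ℝ := ∫ ω, ‖Δ ω‖ ^ 4 ∂P with hm4
  have he10 : 0 ≤ e1 := norm_nonneg _
  have hm20 : 0 ≤ m2 := integral_nonneg fun _ => by positivity
  have hm40 : 0 ≤ m4 := integral_nonneg fun _ => by positivity
  have hsc : MeasurableSet[m] sᶜ := hsm.compl
  have hsc' : MeasurableSet sᶜ := hs'.compl
  have hbad : ∀ ω ∈ sᶜ, ε < ‖Δ ω‖ := fun ω hω => not_le.1 hω
  refine ⟨fun x => R' x - p, hRm.sub_const _, ?_, ?_, ?_⟩
  · intro x
    have e : R' x - p = (∫ ω in s, (gaussDensity (M + Matrix.of (Δ ω)) x / gaussDensity M x - 1 - Λ x (Δ ω)) ∂P)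
        + Λ x (∫ ω in s, Δ ω ∂P) := by
      rw [← (Λ x).integral_comp_comm hiΔ.integrableOn]
      have hli : Integrable (fun ω => Λ x (Δ ω)) (P.restrict s) := (Λ x).integrable_comp hiΔ.integrableOn
      have hmi : Integrable (fun ω => gaussDensity (M + Matrix.of (Δ ω)) x / gaussDensity M x - 1) (P.restrict s) :=
        (hrmi x).sub (integrable_const _)
      rw [integral_sub hmi hli, integral_sub (hrmi x) (integrable_const _)]
      simp [hR', hp]
    have b1 : |∫ ω in s, (gaussDensity (M + Matrix.of (Δ ω)) x / gaussDensity M x - 1 - Λ x (Δ ω)) ∂P|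
        ≤ C * m2 * Real.exp (c * ‖x‖ ^ 2) := by
      calc _ ≤ ∫ ω in s, C * Real.exp (c * ‖x‖ ^ 2) * ‖Δ ω‖ ^ 2 ∂P := by
            rw [← Real.norm_eq_abs]
            refine norm_integral_le_of_norm_le (hi2.integrableOn.const_mul _) ?_
            filter_upwards [ae_restrict_mem hs'] with ω hω
            rw [Real.norm_eq_abs]
            refine (hr1 x ω hω).trans (le_of_eq (by ring))
        _ ≤ ∫ ω, C * Real.exp (c * ‖x‖ ^ 2) * ‖Δ ω‖ ^ 2 ∂P :=
            setIntegral_le_integral (hi2.const_mul _) (Filter.Eventually.of_forall fun ω => by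
              simp only [Pi.zero_apply]; positivity)
        _ = _ := by rw [integral_const_mul]; ring
    have b2 : ‖∫ ω in s, Δ ω ∂P‖ ≤ e1 + m2 / ε := by
      have e2 : ∫ ω in s, Δ ω ∂P = ∫ ω, Δ ω ∂P - ∫ ω in sᶜ, Δ ω ∂P := by
        rw [← integral_add_compl hs' hiΔ]; abel
      rw [e2]
      refine (norm_sub_le _ _).trans ?_
      gcongr
      calc ‖∫ ω in sᶜ, Δ ω ∂P‖ ≤ ∫ ω in sᶜ, ‖Δ ω‖ ^ 2 / ε ∂P := by
            refine norm_integral_le_of_norm_le (hi2.integrableOn.div_const _) ?_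
            filter_upwards [ae_restrict_mem hsc'] with ω hω
            have := hbad ω hω
            rw [le_div_iff₀ hε]
            nlinarith [norm_nonneg (Δ ω)]
        _ ≤ ∫ ω, ‖Δ ω‖ ^ 2 / ε ∂P :=
            setIntegral_le_integral (hi2.div_const _) (Filter.Eventually.of_forall fun ω => by
              simp only [Pi.zero_apply]; positivity)
        _ = _ := by rw [integral_div]
    have b3 : |Λ x (∫ ω in s, Δ ω ∂P)| ≤ C * Real.exp (c * ‖x‖ ^ 2) * (e1 + m2 / ε) := by
      calc _ ≤ ‖Λ x‖ * ‖∫ ω in s, Δ ω ∂P‖ := (Λ x).le_opNorm _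
        _ ≤ _ := by
          have := hΛ x
          gcongr
    have hE := Real.exp_pos (c * ‖x‖ ^ 2)
    change |R' x - p| ≤ _
    rw [e]
    calc _ ≤ C * m2 * Real.exp (c * ‖x‖ ^ 2) + C * Real.exp (c * ‖x‖ ^ 2) * (e1 + m2 / ε) :=
          (abs_add_le _ _).trans (add_le_add b1 b3)
      _ = (C * e1 + (C + C / ε) * m2) * Real.exp (c * ‖x‖ ^ 2) := by ring
      _ ≤ _ := by
        gcongr
        have : C * e1 ≤ Ca * e1 := by
          gcongr
          rw [hCa]
          have : 0 < C / ε := by positivity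
          linarith
        have t1 : 0 ≤ Cb * (e1 + m2) := by positivity
        rw [← hCa]
        nlinarith
  · have h1 := hRφ (fun _ => 1) measurable_const (integrable_const _)
    have h2 : ∀ x, psiF M (fun _ => 1) x = 1 := fun x => by simp [psiF]
    simp only [h2, one_mul] at h1
    rw [integral_sub hRi (integrable_const _), ← h1]
    simp [hp]
  · intro φ hφ hφb
    obtain ⟨q1, q2, q3⟩ := H φ hφ hφb
    have hφF : Integrable (fun ω => φ (F ω)) P := by
      refine Integrable.mono' ((integrable_const (1:ℝ)).add hF2) (hφ.comp_aemeasurable hFm).aestronglyMeasurable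
        (Filter.Eventually.of_forall fun ω => hφb _)
    have hR'b : ∀ x, |R' x| ≤ w x := by
      intro x
      have hwx : 0 ≤ w x := by simp only [hw]; positivity
      rw [hR', ← Real.norm_eq_abs]
      have := norm_setIntegral_le_of_norm_le_const (μ := P) (s := s) (C := w x) (measure_lt_top _ _)
        (f := fun ω => gaussDensity (M + Matrix.of (Δ ω)) x / gaussDensity M x) (fun ω hω => by
          rw [Real.norm_eq_abs, abs_of_nonneg (hr0 _ _)]
          exact hb ω hω x)
      refine this.trans ?_
      exact mul_le_of_le_one_right hwx hp1
    have hψR : Integrable (fun x => psiF M φ x * R' x) (gaussLaw M) := by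
      refine Integrable.mono' (hI3.const_mul (Cψ * (1 + C * ε + C * ε ^ 2)))
        ((psiF_meas hM hφ).mul hRm).aestronglyMeasurable (Filter.Eventually.of_forall fun x => ?_)
      rw [Real.norm_eq_abs, abs_mul]
      calc _ ≤ (Cψ * (1 + ‖x‖ ^ 2)) * w x := mul_le_mul (q1 x) (hR'b x) (abs_nonneg _) (by positivity)
        _ = _ := by simp only [hw]; ring
    have e2 : ∫ x, psiF M φ x * (R' x - p) ∂gaussLaw M =
        ∫ ω in s, φ (F ω) ∂P - p * ∫ x, psiF M φ x ∂gaussLaw M := by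
      rw [hRφ φ hφ hφF.integrableOn, ← integral_const_mul, ← integral_sub hψR (q2.const_mul _)]
      congr 1; ext x; ring
    have e3 : ∫ ω, φ (F ω) ∂P = ∫ ω in s, φ (F ω) ∂P + ∫ ω in sᶜ, φ (F ω) ∂P :=
      (integral_add_compl hs' hφF).symm
    have hJb : |∫ x, psiF M φ x ∂gaussLaw M| ≤ J := by
      rw [← Real.norm_eq_abs, hJ]
      exact norm_integral_le_of_norm_le (hI2.const_mul _) (Filter.Eventually.of_forall q1)
    have hpc : 1 - p = P.real sᶜ := by
      rw [probReal_compl_eq_one_sub hs']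
    have hm4s : ∫ ω in sᶜ, ‖Δ ω‖ ^ 4 ∂P ≤ m4 :=
      setIntegral_le_integral hi4 (Filter.Eventually.of_forall fun ω => by
              simp only [Pi.zero_apply]; positivity)
    have hpb : P.real sᶜ ≤ m4 / ε ^ 4 := by
      rw [le_div_iff₀ (by positivity)]
      calc P.real sᶜ * ε ^ 4 = ∫ ω in sᶜ, ε ^ 4 ∂P := by simp
        _ ≤ ∫ ω in sᶜ, ‖Δ ω‖ ^ 4 ∂P := by
          refine setIntegral_mono_on (integrable_const _) hi4.integrableOn hsc' fun ω hω => ?_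
          have := (hbad ω hω).le
          gcongr
        _ ≤ m4 := hm4s
    have hFb : ∫ ω in sᶜ, ‖F ω‖ ^ 2 ∂P ≤ d * (3 * (k / ε ^ 4 + 1 / ε ^ 3)) * m4 := by
      refine (hFs _ hsc).trans ?_
      calc ∑ i, 3 * ∫ ω in sᶜ, A ω i i ∂P ≤ ∑ i : Fin d, 3 * ((k / ε ^ 4 + 1 / ε ^ 3) * m4) := by
            refine Finset.sum_le_sum fun i _ => ?_
            gcongr
            calc ∫ ω in sᶜ, A ω i i ∂P ≤ ∫ ω in sᶜ, (k / ε ^ 4 + 1 / ε ^ 3) * ‖Δ ω‖ ^ 4 ∂P := by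
                  refine setIntegral_mono_on (hAi i).integrableOn (hi4.integrableOn.const_mul _) hsc' fun ω hω => ?_
                  have hb' := (hbad ω hω).le
                  rw [hAii]
                  have a1 : (M + M) i i ≤ k := hkle i
                  have a2 : Δ ω i i ≤ ‖Δ ω‖ :=
                    (le_abs_self _).trans ((norm_le_pi_norm (Δ ω i) i).trans
                      (norm_le_pi_norm (Δ ω) i))
                  have a3 : k ≤ k / ε ^ 4 * ‖Δ ω‖ ^ 4 := by
                    rw [div_mul_eq_mul_div, le_div_iff₀ (by positivity)]
                    gcongr
                  have a4 : ‖Δ ω‖ ≤ 1 / ε ^ 3 * ‖Δ ω‖ ^ 4 := by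
                    rw [div_mul_eq_mul_div, le_div_iff₀ (by positivity), one_mul]
                    calc ‖Δ ω‖ * ε ^ 3 ≤ ‖Δ ω‖ * ‖Δ ω‖ ^ 3 := by gcongr
                      _ = _ := by ring
                  linarith
              _ ≤ _ := by
                rw [integral_const_mul]
                gcongr
        _ = _ := by simp; ring
    have hφbad : |∫ ω in sᶜ, φ (F ω) ∂P| ≤ P.real sᶜ + ∫ ω in sᶜ, ‖F ω‖ ^ 2 ∂P := by
      rw [← Real.norm_eq_abs]
      refine (norm_integral_le_of_norm_le ((integrable_const (1:ℝ)).add hF2.integrableOn)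
        (Filter.Eventually.of_forall fun ω => hφb _)).trans (le_of_eq ?_)
      simp only [Pi.add_apply]
      rw [integral_add (integrable_const _) hF2.integrableOn]
      simp
    rw [e2, e3, q3]
    have e4 : ∫ ω in s, φ (F ω) ∂P + ∫ ω in sᶜ, φ (F ω) ∂P - ∫ x, psiF M φ x ∂gaussLaw M -
        (∫ ω in s, φ (F ω) ∂P - p * ∫ x, psiF M φ x ∂gaussLaw M) =
        ∫ ω in sᶜ, φ (F ω) ∂P - P.real sᶜ * ∫ x, psiF M φ x ∂gaussLaw M := by
      rw [← hpc]; ring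
    rw [e4]
    have hq0 : 0 ≤ P.real sᶜ := measureReal_nonneg
    have b5 : |P.real sᶜ * ∫ x, psiF M φ x ∂gaussLaw M| ≤ P.real sᶜ * J := by
      rw [abs_mul, abs_of_nonneg hq0]
      gcongr
    calc _ ≤ (P.real sᶜ + ∫ ω in sᶜ, ‖F ω‖ ^ 2 ∂P) + P.real sᶜ * J :=
          (abs_sub _ _).trans (add_le_add hφbad b5)
      _ = P.real sᶜ * (1 + J) + ∫ ω in sᶜ, ‖F ω‖ ^ 2 ∂P := by ring
      _ ≤ m4 / ε ^ 4 * (1 + J) + d * (3 * (k / ε ^ 4 + 1 / ε ^ 3)) * m4 := by gcongr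
      _ = Cb * m4 := by rw [hCb]; ring
      _ ≤ (Ca + Cb) * m4 := mul_le_mul_of_nonneg_right (by linarith) hm40

open MeasureTheory ProbabilityTheory Matrix
open scoped ENNReal NNReal

lemma sq_integral_le {Ω : Type*} {mΩ : MeasurableSpace Ω} {P : Measure Ω} [IsProbabilityMeasure P]
    {f : Ω → ℝ} (hf : Integrable f P) (hf2 : Integrable (fun ω => f ω ^ 2) P) :
    (∫ ω, f ω ∂P) ^ 2 ≤ ∫ ω, f ω ^ 2 ∂P := by
  set a := ∫ ω, f ω ∂P with ha
  have h0 : 0 ≤ ∫ ω, (f ω - a) ^ 2 ∂P := integral_nonneg fun ω => sq_nonneg _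
  have e : ∫ ω, (f ω - a) ^ 2 ∂P = ∫ ω, f ω ^ 2 ∂P - 2 * a * a + a ^ 2 := by
    have h1 : (fun ω => (f ω - a) ^ 2) = fun ω => (f ω ^ 2 - 2 * a * f ω) + a ^ 2 := by
      ext ω; ring
    have h2 : Integrable (fun ω => f ω ^ 2 - 2 * a * f ω) P := hf2.sub (hf.const_mul _)
    rw [h1, integral_add h2 (integrable_const _), integral_sub hf2 (hf.const_mul _),
      integral_const_mul, ← ha]
    simp
  nlinarith

lemma hsNorm_sq {d : ℕ} (N : Matrix (Fin d) (Fin d) ℝ) : hsNorm N ^ 2 = ∑ i, ∑ j, N i j ^ 2 :=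
  Real.sq_sqrt (Finset.sum_nonneg fun i _ => Finset.sum_nonneg fun j _ => sq_nonneg _)

lemma hsNorm_nonneg {d : ℕ} (N : Matrix (Fin d) (Fin d) ℝ) : 0 ≤ hsNorm N := Real.sqrt_nonneg _

lemma norm_le_hsNorm {d : ℕ} (v : Fin d → Fin d → ℝ) (N : Matrix (Fin d) (Fin d) ℝ)
    (h : ∀ i j, v i j = N i j) : ‖v‖ ≤ hsNorm N := by
  refine (pi_norm_le_iff_of_nonneg (hsNorm_nonneg N)).2 fun i =>
    (pi_norm_le_iff_of_nonneg (hsNorm_nonneg N)).2 fun j => ?_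
  rw [h, Real.norm_eq_abs]
  refine Real.abs_le_sqrt ?_
  exact (Finset.single_le_sum (f := fun j => N i j ^ 2) (fun j _ => sq_nonneg _) (Finset.mem_univ j)).trans
    (Finset.single_le_sum (f := fun i => ∑ j, N i j ^ 2)
      (fun i _ => Finset.sum_nonneg fun j _ => sq_nonneg _) (Finset.mem_univ i))

lemma hsNorm_sub_pow {d : ℕ} (N K : Matrix (Fin d) (Fin d) ℝ) :
    hsNorm (N - K) ^ 8 ≤ 128 * (hsNorm N ^ 8 + hsNorm K ^ 8) := by
  have h2 : hsNorm (N - K) ^ 2 ≤ 2 * (hsNorm N ^ 2 + hsNorm K ^ 2) := by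
    rw [hsNorm_sq, hsNorm_sq, hsNorm_sq, ← Finset.sum_add_distrib, Finset.mul_sum]
    refine Finset.sum_le_sum fun i _ => ?_
    rw [← Finset.sum_add_distrib, Finset.mul_sum]
    refine Finset.sum_le_sum fun j _ => ?_
    rw [Matrix.sub_apply]
    nlinarith [sq_nonneg (N i j + K i j)]
  have h4 : (hsNorm (N - K) ^ 2) ^ 2 ≤ (2 * (hsNorm N ^ 2 + hsNorm K ^ 2)) ^ 2 := by gcongr
  have h4' : (hsNorm (N - K) ^ 2) ^ 2 ≤ 8 * (hsNorm N ^ 4 + hsNorm K ^ 4) := by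
    nlinarith [sq_nonneg (hsNorm N ^ 2 - hsNorm K ^ 2)]
  have h8 : ((hsNorm (N - K) ^ 2) ^ 2) ^ 2 ≤ (8 * (hsNorm N ^ 4 + hsNorm K ^ 4)) ^ 2 := by gcongr
  have e : hsNorm (N - K) ^ 8 = ((hsNorm (N - K) ^ 2) ^ 2) ^ 2 := by ring
  rw [e]
  nlinarith [sq_nonneg (hsNorm N ^ 4 - hsNorm K ^ 4)]

lemma moments {Ω : Type*} {mΩ : MeasurableSpace Ω} {P : Measure Ω} [IsProbabilityMeasure P]
    {h : Ω → ℝ} (h0 : ∀ ω, 0 ≤ h ω) (hm : Measurable h) (hi : Integrable (fun ω => h ω ^ 8) P) :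
    Integrable (fun ω => h ω ^ 2) P ∧ Integrable (fun ω => h ω ^ 4) P ∧
    ∫ ω, h ω ^ 2 ∂P ≤ (∫ ω, h ω ^ 8 ∂P) ^ ((1:ℝ)/4) ∧
    ∫ ω, h ω ^ 4 ∂P ≤ ((∫ ω, h ω ^ 8 ∂P) ^ ((1:ℝ)/4)) ^ 2 := by
  have i4 : Integrable (fun ω => h ω ^ 4) P := by
    refine Integrable.mono' ((integrable_const (1:ℝ)).add hi) (hm.pow_const 4).aestronglyMeasurable
      (Filter.Eventually.of_forall fun ω => ?_)
    simp only [Pi.add_apply]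
    rw [Real.norm_eq_abs, abs_of_nonneg (by have := h0 ω; positivity)]
    nlinarith [sq_nonneg (h ω ^ 4 - 1), sq_nonneg (h ω ^ 4)]
  have i2 : Integrable (fun ω => h ω ^ 2) P := by
    refine Integrable.mono' ((integrable_const (1:ℝ)).add i4) (hm.pow_const 2).aestronglyMeasurable
      (Filter.Eventually.of_forall fun ω => ?_)
    simp only [Pi.add_apply]
    rw [Real.norm_eq_abs, abs_of_nonneg (by have := h0 ω; positivity)]
    nlinarith [sq_nonneg (h ω ^ 2 - 1), sq_nonneg (h ω ^ 2)]
  set D := ∫ ω, h ω ^ 8 ∂P with hD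
  have hD0 : 0 ≤ D := integral_nonneg fun ω => by have := h0 ω; positivity
  set q := D ^ ((1:ℝ)/4) with hq
  have hq0 : 0 ≤ q := Real.rpow_nonneg hD0 _
  have hq4 : q ^ 4 = D := by
    rw [hq, ← Real.rpow_natCast, ← Real.rpow_mul hD0]; norm_num
  have e4 : ∀ ω, (h ω ^ 4) ^ 2 = h ω ^ 8 := fun ω => by ring
  have e2 : ∀ ω, (h ω ^ 2) ^ 2 = h ω ^ 4 := fun ω => by ring
  have s4 := sq_integral_le i4 (by simpa only [e4] using hi)
  have s2 := sq_integral_le i2 (by simpa only [e2] using i4)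
  simp only [e4] at s4
  simp only [e2] at s2
  have r4 : ∫ ω, h ω ^ 4 ∂P ≤ q ^ 2 := by
    refine le_of_sq_le_sq (s4.trans (le_of_eq ?_)) (by positivity)
    rw [← hD, ← hq4]; ring
  refine ⟨i2, i4, le_of_sq_le_sq (s2.trans r4) hq0, r4⟩

open MeasureTheory ProbabilityTheory Matrix
open scoped ENNReal NNReal

set_option maxHeartbeats 2000000 in
/-- Theorem `th_gen_tv_2w`: TV and 2-Wasserstein bounds with constants
depending only on `d` and `K`. -/
theorem statement_1
    {d : ℕ} (hd : 1 ≤ d)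
    (K : Matrix (Fin d) (Fin d) ℝ) (hK : K.PosDef) :
    ∃ C₃ C₄ : ℝ, 0 < C₃ ∧ 0 < C₄ ∧
      ∀ (Ω : Type) (mΩ : MeasurableSpace Ω) (P : Measure Ω), IsProbabilityMeasure P →
      ∀ (G F : Ω → Fin d → ℝ), Measure.map G P = gaussLaw K →
      ∀ (𝓕 : {m : MeasurableSpace Ω // m ≤ mΩ}) (A : Ω → Matrix (Fin d) (Fin d) ℝ),
        CondGaussian P F 𝓕.1 A →
        Integrable (fun ω => hsNorm (A ω) ^ 8) P →
        max (dTV (Measure.map F P) (Measure.map G P)) (W2 (Measure.map F P) (Measure.map G P)) ≤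
          C₃ * hsNorm ((Matrix.of fun i j => ∫ ω, A ω i j ∂P) - K)
          + C₄ * (∫ ω, hsNorm (A ω - K) ^ 8 ∂P) ^ ((1 : ℝ) / 4) := by
  obtain ⟨M, hM, hMM⟩ : ∃ M : Matrix (Fin d) (Fin d) ℝ, M.PosDef ∧ M + M = K := by
    refine ⟨(1/2 : ℝ) • K, hK.smul (by norm_num), ?_⟩
    rw [← add_smul]; norm_num
  obtain ⟨c, C, hc, hC, hci, hφ, hcpl⟩ := core hM
  obtain ⟨C₁, hC₁, hps⟩ := prob_side hM hc hci C hC (fun φ h1 h2 => (hφ φ h1 h2).2.2)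
  obtain ⟨hI1, hI2, hI3⟩ := exp_int hM hc hci
  have hgauss : IsGaussian (gaussLaw M) := gaussLaw_isGaussian hM
  have hgaussK : IsGaussian (gaussLaw K) := gaussLaw_isGaussian hK
  set L : ℝ := ∫ x : Fin d → ℝ, C * ((1 + ‖x‖ ^ 2) * Real.exp (c * ‖x‖ ^ 2)) ∂gaussLaw M with hL
  have hL0 : 0 ≤ L := integral_nonneg fun x => by positivity
  set E : ℝ := 2 * (C * C₁ ^ 2) + 2 * (2 * (C * C₁ ^ 2 + C₁)) with hE
  have hE0 : 0 < E := by positivity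
  set Cf : ℝ := C₁ * (L + 1) + 1 + Real.sqrt d * Real.sqrt E with hCf
  have hCf0 : 0 < Cf := by positivity
  clear_value L E Cf
  refine ⟨Cf, Cf, hCf0, hCf0, ?_⟩
  intro Ω mΩ P hP G F hG 𝓕 A hcg hA8
  have hm := 𝓕.2
  rw [hG]
  set Δ : Ω → Fin d → Fin d → ℝ := fun ω i j => A ω i j - K i j with hΔ
  have hAm : Measurable[𝓕.1] (fun ω i j => A ω i j) := hcg.2.2.2.1
  have hAm' : Measurable (fun ω i j => A ω i j) := hAm.mono hm le_rfl
  have hΔm : Measurable[𝓕.1] Δ := hAm.sub_const (fun i j => K i j)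
  have hΔm' : Measurable Δ := hΔm.mono hm le_rfl
  have hAΔ : ∀ ω, A ω = M + (M + Matrix.of (Δ ω)) := by
    intro ω
    rw [← add_assoc, hMM]
    ext i j
    simp [hΔ]
  set h : Ω → ℝ := fun ω => hsNorm (A ω - K) with hh
  have hh0 : ∀ ω, 0 ≤ h ω := fun ω => hsNorm_nonneg _
  have hΔh : ∀ ω, ‖Δ ω‖ ≤ h ω := fun ω => norm_le_hsNorm _ _ fun i j => rfl
  have hmeas : ∀ i j, Measurable (fun ω => A ω i j) := fun i j =>
    (measurable_pi_apply j).comp ((measurable_pi_apply i).comp hAm')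
  have hhm : Measurable h := by
    simp only [hh, hsNorm, Matrix.sub_apply]
    refine Real.continuous_sqrt.measurable.comp ?_
    exact Finset.measurable_sum _ fun i _ => Finset.measurable_sum _ fun j _ =>
      ((hmeas i j).sub_const _).pow_const 2
  have hh8 : Integrable (fun ω => h ω ^ 8) P := by
    refine Integrable.mono' ((hA8.add (integrable_const (hsNorm K ^ 8))).const_mul 128)
      (hhm.pow_const 8).aestronglyMeasurable (Filter.Eventually.of_forall fun ω => ?_)
    rw [Real.norm_eq_abs, abs_of_nonneg (by have := hh0 ω; positivity)]
    exact hsNorm_sub_pow _ _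
  obtain ⟨i2, i4, hm2, hm4⟩ := moments hh0 hhm hh8
  have hi4 : Integrable (fun ω => ‖Δ ω‖ ^ 4) P := by
    refine Integrable.mono' i4 (hΔm'.norm.pow_const 4).aestronglyMeasurable
      (Filter.Eventually.of_forall fun ω => ?_)
    rw [Real.norm_eq_abs, abs_of_nonneg (by positivity)]
    have := hΔh ω
    gcongr
  have hi2 : Integrable (fun ω => ‖Δ ω‖ ^ 2) P := by
    refine Integrable.mono' i2 (hΔm'.norm.pow_const 2).aestronglyMeasurable
      (Filter.Eventually.of_forall fun ω => ?_)
    rw [Real.norm_eq_abs, abs_of_nonneg (by positivity)]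
    have := hΔh ω
    gcongr
  have hiΔ : Integrable Δ P := by
    refine Integrable.mono' ((integrable_const (1:ℝ)).add hi2) hΔm'.aestronglyMeasurable
      (Filter.Eventually.of_forall fun ω => ?_)
    simp only [Pi.add_apply]
    nlinarith [sq_nonneg (‖Δ ω‖ - 1), norm_nonneg (Δ ω)]
  set q : ℝ := (∫ ω, h ω ^ 8 ∂P) ^ ((1:ℝ)/4) with hq
  have hq0 : 0 ≤ q := Real.rpow_nonneg (integral_nonneg fun ω => by have := hh0 ω; positivity) _
  set a : ℝ := hsNorm ((Matrix.of fun i j => ∫ ω, A ω i j ∂P) - K) with ha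
  have ha0 : 0 ≤ a := hsNorm_nonneg _
  have he1 : ‖∫ ω, Δ ω ∂P‖ ≤ a := by
    refine norm_le_hsNorm _ _ fun i j => ?_
    rw [eval_integral (fun i => hiΔ.eval i), eval_integral (fun j => (hiΔ.eval i).eval j)]
    have hIntg : Integrable (fun ω => A ω i j) P := by
      have := ((hiΔ.eval i).eval j).add (integrable_const (K i j))
      refine this.congr (Filter.Eventually.of_forall fun ω => ?_)
      simp [hΔ]
    simp only [hΔ]
    rw [integral_sub hIntg (integrable_const _)]
    simp
  have hm2' : ∫ ω, ‖Δ ω‖ ^ 2 ∂P ≤ q := by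
    refine le_trans (integral_mono hi2 i2 fun ω => ?_) hm2
    have := hΔh ω
    simp only
    gcongr
  have hm4' : ∫ ω, ‖Δ ω‖ ^ 4 ∂P ≤ q ^ 2 := by
    refine le_trans (integral_mono hi4 i4 fun ω => ?_) hm4
    have := hΔh ω
    simp only
    gcongr
  clear_value q a Δ h
  obtain ⟨hF2, R, hRm, hRb, hR0, hRφ⟩ := hps Ω 𝓕.1 mΩ hm P hP F A Δ hcg hΔm hAΔ hi4
  set δ : ℝ := a + q with hδ
  have hδ0 : 0 ≤ δ := by positivity
  have hqδ : q ^ 2 ≤ δ ^ 2 := by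
    have : q ≤ δ := by linarith
    gcongr
  have hRb' : ∀ x, |R x| ≤ (C₁ * δ) * Real.exp (c * ‖x‖ ^ 2) := by
    intro x
    refine (hRb x).trans ?_
    gcongr
    linarith
  have hRφ' : ∀ φ : (Fin d → ℝ) → ℝ, Measurable φ → (∀ x, |φ x| ≤ 1 + ‖x‖ ^ 2) →
      |∫ ω, φ (F ω) ∂P - ∫ x, φ x ∂gaussLaw K - ∫ x, psiF M φ x * R x ∂gaussLaw M| ≤ C₁ * δ ^ 2 := by
    intro φ h1 h2
    have := hRφ φ h1 h2
    rw [hMM] at this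
    refine this.trans ?_
    gcongr
    exact hm4'.trans hqδ
  clear_value δ
  have hFm : AEMeasurable F P := hcg.1.1.aemeasurable
  have hPF : IsProbabilityMeasure (P.map F) := Measure.isProbabilityMeasure_map hFm
  have hgoal : max (dTV (P.map F) (gaussLaw K)) (W2 (P.map F) (gaussLaw K)) ≤ Cf * δ := by
    have hs1 : 0 ≤ Real.sqrt d * Real.sqrt E * δ := by positivity
    have hs2 : 0 ≤ (C₁ * (L + 1) + 1) * δ := by positivity
    have hCfδ : Cf * δ = (C₁ * (L + 1) + 1) * δ + Real.sqrt d * Real.sqrt E * δ := by rw [hCf]; ring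
    refine max_le ?_ ?_
    · refine le_trans ?_ (by rw [hCfδ]; linarith : (C₁ * (L + 1) + 1) * δ ≤ Cf * δ)
      refine Real.sSup_le ?_ hs2
      rintro r ⟨B, hB, rfl⟩
      have hψR : ∀ φ : (Fin d → ℝ) → ℝ, Measurable φ → (∀ x, |φ x| ≤ 1 + ‖x‖ ^ 2) →
          |∫ x, psiF M φ x * R x ∂gaussLaw M| ≤ C₁ * δ * L := by
        intro φ h1 h2
        rw [hL, ← integral_const_mul, ← Real.norm_eq_abs]
        refine norm_integral_le_of_norm_le ((hI3.const_mul _).const_mul _)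
          (Filter.Eventually.of_forall fun x => ?_)
        rw [Real.norm_eq_abs, abs_mul]
        calc _ ≤ (C * (1 + ‖x‖ ^ 2)) * (C₁ * δ * Real.exp (c * ‖x‖ ^ 2)) :=
              mul_le_mul ((hφ φ h1 h2).2.2.1 x) (hRb' x) (abs_nonneg _) (by positivity)
          _ = _ := by ring
      rcases le_total 1 δ with h1 | h1
      · have b1 : (P.map F B).toReal ≤ 1 := measureReal_le_one (μ := P.map F) (s := B)
        have b2 : (gaussLaw K B).toReal ≤ 1 := measureReal_le_one (μ := gaussLaw K) (s := B)
        have b3 : 0 ≤ (P.map F B).toReal := ENNReal.toReal_nonneg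
        have b4 : 0 ≤ (gaussLaw K B).toReal := ENNReal.toReal_nonneg
        have : 0 ≤ C₁ * (L + 1) * δ := by positivity
        rw [abs_le]
        constructor <;> nlinarith
      · set φ : (Fin d → ℝ) → ℝ := B.indicator (fun _ => 1) with hφd
        have hφm : Measurable φ := measurable_const.indicator hB
        have hφb : ∀ x, |φ x| ≤ 1 + ‖x‖ ^ 2 := by
          intro x
          have : |φ x| ≤ 1 := by
            simp only [hφd, Set.indicator]
            split_ifs <;> simp
          nlinarith [sq_nonneg ‖x‖]
        have q1 := hRφ' φ hφm hφb
        have q2 := hψR φ hφm hφb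
        rw [← integral_map (f := φ) hFm hφm.aestronglyMeasurable] at q1
        simp only [hφd] at q1 q2
        rw [integral_indicator_const _ hB, integral_indicator_const _ hB] at q1
        simp only [smul_eq_mul, mul_one] at q1
        change |(P.map F).real B - (gaussLaw K).real B| ≤ _
        have q3 : δ ^ 2 ≤ δ := by nlinarith
        have q4 : C₁ * δ ^ 2 ≤ C₁ * δ := by gcongr
        calc _ ≤ C₁ * δ ^ 2 + C₁ * δ * L := by
              have := abs_le.1 q1
              have := abs_le.1 q2
              rw [abs_le]
              constructor <;> linarith
          _ ≤ _ := by nlinarith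
    · refine le_trans ?_ (by rw [hCfδ]; linarith : Real.sqrt d * Real.sqrt E * δ ≤ Cf * δ)
      obtain ⟨π₀, hπ₀, hπ1, hπc, hπi, hπφ⟩ := hcpl R (C₁ * δ) (by positivity) hRm hRb' hR0
      have hSp : IsProbabilityMeasure (π₀.map Prod.snd) :=
        Measure.isProbabilityMeasure_map measurable_snd.aemeasurable
      have hFi : Integrable (fun x => ‖x‖ ^ 2) (P.map F) :=
        (integrable_map_measure (by fun_prop) hFm).2 hF2
      obtain ⟨π₁, hπ₁, hq1, hq2, hqc⟩ := residual_coupling (π₀.map Prod.snd) (P.map F) hπi hFi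
        (C * (C₁ * δ) ^ 2 + C₁ * δ ^ 2) (by
          intro φ h1 h2
          have t1 := abs_le.1 (hπφ φ h1 h2)
          have t2 := abs_le.1 (hRφ' φ h1 h2)
          rw [hMM] at t1
          rw [integral_map (f := φ) hFm h1.aestronglyMeasurable, abs_le]
          constructor <;> linarith)
      obtain ⟨π, hπ, hp1, hp2, hpc⟩ := glue_coupling π₀ π₁ hq1.symm
      rw [hπ1, hMM] at hp1
      rw [hq2] at hp2
      rw [mul_assoc]
      refine W2_le_of_coupling _ _ π hp1 hp2 (Real.sqrt E * δ) (by positivity) (hpc.trans ?_)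
      have two : (2 : ℝ≥0∞) = ENNReal.ofReal 2 := by simp
      calc _ ≤ 2 * ENNReal.ofReal (C * (C₁ * δ) ^ 2) +
            2 * ENNReal.ofReal (2 * (C * (C₁ * δ) ^ 2 + C₁ * δ ^ 2)) := by gcongr
        _ = ENNReal.ofReal ((Real.sqrt E * δ) ^ 2) := by
          rw [two, ← ENNReal.ofReal_mul (by norm_num), ← ENNReal.ofReal_mul (by norm_num),
            ← ENNReal.ofReal_add (by positivity) (by positivity), mul_pow (Real.sqrt E), Real.sq_sqrt hE0.le, hE]
          congr 1; ring
  refine hgoal.trans (le_of_eq ?_)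
  rw [hδ]; ring
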